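/- arXiv:2109.04246 — 2 statements merged into one kernel-verified Lean document; each statement's English description precedes it below -/
import Mathlib

section
/- Let f : X → X be an orientation-preserving homeomorphism of the circle S¹. Then the induced map C(f) on the hyperspace of subcontinua of S¹ has no Li–Yorke pair; in particular it is not chaotic in the Li–Yorke sense. -/
open Filter TopologicalSpace

/-- The hyperspace of subcontinua of `X` with the Hausdorff metric. -/
abbrev Subcontinua (X : Type*) [MetricSpace X] : Type _ :=
  {A : NonemptyCompacts X // IsConnected (A : Set X)}

/-- The induced map `C(f)` on the hyperspace of subcontinua. -/
noncomputable def inducedC {X : Type*} [MetricSpace X] (f : X → X) (hf : Continuous f) :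
    Subcontinua X → Subcontinua X :=
  fun A => ⟨⟨⟨f '' (A.1 : Set X), A.1.isCompact.image hf⟩, A.1.nonempty.image f⟩,
    A.2.image f hf.continuousOn⟩

/-- A pair is proximal if `liminf dist (fⁿ x) (fⁿ y) = 0`. -/
def Proximal {Z : Type*} [MetricSpace Z] (g : Z → Z) (x y : Z) : Prop :=
  liminf (fun n : ℕ => dist (g^[n] x) (g^[n] y)) atTop = 0

/-- A pair is asymptotic if `limsup dist (fⁿ x) (fⁿ y) = 0`. -/
def Asymptotic {Z : Type*} [MetricSpace Z] (g : Z → Z) (x y : Z) : Prop :=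
  limsup (fun n : ℕ => dist (g^[n] x) (g^[n] y)) atTop = 0

/-- A Li–Yorke pair is a proximal non-asymptotic pair. -/
def LiYorke {Z : Type*} [MetricSpace Z] (g : Z → Z) (x y : Z) : Prop :=
  Proximal g x y ∧ ¬ Asymptotic g x y

section RealLine

variable {F : ℝ → ℝ}

lemma cl_int (hdeg : ∀ x : ℝ, F (x + 1) = F x + 1) (x : ℝ) (m : ℤ) : F (x + m) = F x + m := by
  have hn : ∀ (n : ℕ) (x : ℝ), F (x + n) = F x + n := by
    intro n
    induction n with
    | zero => simp
    | succ k ih =>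
      intro x
      push_cast
      rw [← add_assoc, hdeg, ih, add_assoc]
  obtain ⟨n, rfl | rfl⟩ := m.eq_nat_or_neg
  · simpa using hn n x
  · have := hn n (x - n)
    simp only [sub_add_cancel] at this
    push_cast
    rw [← sub_eq_add_neg]
    linarith

lemma cl_iter_int (hint : ∀ (x : ℝ) (m : ℤ), F (x + m) = F x + m) (n : ℕ) (x : ℝ) (m : ℤ) :
    F^[n] (x + m) = F^[n] x + m := by
  induction n generalizing x with
  | zero => simp
  | succ k ih => simp only [Function.iterate_succ, Function.comp_apply]; rw [hint, ih]

lemma cl_iter_sub (hint : ∀ (x : ℝ) (m : ℤ), F (x + m) = F x + m) (n : ℕ) (x : ℝ) (m : ℤ) :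
    F^[n] (x - m) = F^[n] x - m := by
  have := cl_iter_int hint n x (-m)
  push_cast at this
  simpa [sub_eq_add_neg] using this

/-- The overlap-free condition. -/
def Wand (F : ℝ → ℝ) (x y : ℝ) : Prop :=
  ∀ (k : ℕ), 1 ≤ k → ∀ p : ℤ, min y (F^[k] y - p) ≤ max x (F^[k] x - p)

lemma wand_closed_right (hc : Continuous F) (x : ℝ) : IsClosed {y | Wand F x y} := by
  simp only [Wand, Set.ofPred_forall]
  refine isClosed_iInter fun k => isClosed_iInter fun _ => isClosed_iInter fun p => ?_
  have := hc.iterate k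
  exact isClosed_le (by fun_prop) (by fun_prop)

lemma wand_closed_left (hc : Continuous F) (y : ℝ) : IsClosed {x | Wand F x y} := by
  simp only [Wand, Set.ofPred_forall]
  refine isClosed_iInter fun k => isClosed_iInter fun _ => isClosed_iInter fun p => ?_
  have := hc.iterate k
  exact isClosed_le (by fun_prop) (by fun_prop)

lemma wand_tendsto (hmono : StrictMono F) (hint : ∀ (x : ℝ) (m : ℤ), F (x + m) = F x + m)
    {x y : ℝ} (hW : Wand F x y) (ε : ℝ) (hε : 0 < ε) :
    ∀ᶠ n in atTop, F^[n] y - F^[n] x < ε := by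
  by_contra hcon
  have hinf : {n | ε ≤ F^[n] y - F^[n] x}.Infinite := by
    rw [← Nat.frequently_atTop_iff_infinite]
    simpa only [Filter.not_eventually, not_lt] using hcon
  obtain ⟨N, hN⟩ := exists_nat_gt (1 / ε)
  have hNpos : (0 : ℝ) < N := lt_trans (by positivity) hN
  have hNε : 1 < N * ε := by rwa [div_lt_iff₀ hε] at hN
  have key : ∀ m n : ℕ, m < n → ε ≤ F^[m] y - F^[m] x → ε ≤ F^[n] y - F^[n] x →
      ⌊Int.fract (F^[m] x) * N⌋ = ⌊Int.fract (F^[n] x) * N⌋ → False := by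
    intro m n hmn h1 h2 h3
    have h4 := Int.abs_sub_lt_one_of_floor_eq_floor h3
    rw [← sub_mul, abs_mul, abs_of_pos hNpos] at h4
    have h5 : |Int.fract (F^[m] x) - Int.fract (F^[n] x)| < ε := by
      by_contra h
      push Not at h
      nlinarith
    set p : ℤ := ⌊F^[n] x⌋ - ⌊F^[m] x⌋ with hp
    have h6 : |F^[m] x - (F^[n] x - p)| < ε := by
      convert h5 using 2
      rw [hp, Int.fract, Int.fract]; push_cast; ring
    have h7 : max (F^[m] x) (F^[n] x - p) < min (F^[m] y) (F^[n] y - p) := by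
      rw [abs_lt] at h6
      rw [max_lt_iff, lt_min_iff, lt_min_iff]
      refine ⟨⟨?_, ?_⟩, ?_, ?_⟩ <;> linarith
    have h8 := hW (n - m) (by omega) p
    have hm : Monotone F^[m] := (hmono.iterate m).monotone
    have h9 := hm h8
    rw [hm.map_min, hm.map_max, cl_iter_sub hint, cl_iter_sub hint,
      ← Function.iterate_add_apply, ← Function.iterate_add_apply,
      Nat.add_sub_cancel' hmn.le] at h9
    exact absurd h7 (not_lt.mpr h9)
  obtain ⟨m, hm, n, hn, hne, heq⟩ := hinf.exists_ne_map_eq_of_mapsTo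
    (f := fun n => ⌊Int.fract (F^[n] x) * N⌋) (t := Set.Icc (0 : ℤ) N) (by
      intro n _
      have h0 := Int.fract_nonneg (F^[n] x)
      have h1 := Int.fract_lt_one (F^[n] x)
      constructor
      · exact Int.floor_nonneg.mpr (by positivity)
      · have : Int.fract (F^[n] x) * N ≤ ((N : ℤ) : ℝ) := by push_cast; nlinarith
        have := (Int.floor_le _).trans this
        exact_mod_cast this) (Set.finite_Icc _ _)
  rcases lt_or_gt_of_ne hne with h | h
  · exact key m n h hm hn heq
  · exact key n m h hn hm heq.symm

lemma no_fix_delta (hc : Continuous F) (hint : ∀ (x : ℝ) (m : ℤ), F (x + m) = F x + m)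
    (k : ℕ) (p : ℤ) (hnf : ∀ z, F^[k] z ≠ z + p) :
    ∃ δ > 0, ∀ z, δ ≤ |F^[k] z - p - z| := by
  have hck := hc.iterate k
  obtain ⟨w, -, hw⟩ := (isCompact_Icc (a := (0 : ℝ)) (b := 1)).exists_isMinOn ⟨0, by simp⟩
    (f := fun z => |F^[k] z - p - z|) (by fun_prop)
  refine ⟨|F^[k] w - p - w|, abs_pos.mpr fun h => hnf w (by linarith), fun z => ?_⟩
  have h1 := hw (show Int.fract z ∈ Set.Icc (0 : ℝ) 1 from
    ⟨Int.fract_nonneg z, (Int.fract_lt_one z).le⟩)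
  simp only [Set.mem_ofPred_eq] at h1
  have h2 : F^[k] (Int.fract z) - p - Int.fract z = F^[k] z - p - z := by
    rw [Int.fract, cl_iter_sub hint]; ring
  rwa [h2] at h1

lemma not_wand_delta (hmono : StrictMono F) (hc : Continuous F)
    (hint : ∀ (x : ℝ) (m : ℤ), F (x + m) = F x + m)
    (hnf : ∀ k : ℕ, 1 ≤ k → ∀ (p : ℤ) z, F^[k] z ≠ z + p)
    {x y : ℝ} (hW : ¬ Wand F x y) :
    ∃ δ > 0, ∀ᶠ n in atTop, δ ≤ F^[n] y - F^[n] x := by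
  simp only [Wand, not_forall, not_le] at hW
  obtain ⟨k, hk, p, h⟩ := hW
  obtain ⟨δ, hδ, hd⟩ := no_fix_delta hc hint k p (hnf k hk p)
  refine ⟨δ, hδ, ?_⟩
  have hcomm : ∀ (j : ℕ) (a : ℝ), F^[j] (F^[k] a - p) = F^[k] (F^[j] a) - p := by
    intro j a
    rw [cl_iter_sub hint, ← Function.iterate_add_apply, ← Function.iterate_add_apply, add_comm]
  rw [max_lt_iff, lt_min_iff, lt_min_iff] at h
  obtain ⟨⟨h1, h2⟩, h3, h4⟩ := h
  rw [eventually_atTop]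
  refine ⟨k, fun n hn => ?_⟩
  rcases le_total x (F^[k] x - p) with hx | hx
  · have e1 := (hmono.iterate n).monotone hx
    have e2 := (hmono.iterate n).monotone h3.le
    rw [hcomm] at e1 e2
    have := hd (F^[n] x)
    rw [abs_of_nonneg (by linarith)] at this
    linarith
  · obtain ⟨j, rfl⟩ := Nat.exists_eq_add_of_le hn
    have e1 := (hmono.iterate j).monotone hx
    have e2 := (hmono.iterate j).monotone h2.le
    rw [hcomm] at e1 e2
    have := hd (F^[j] x)
    rw [abs_of_nonpos (by linarith)] at this
    rw [Function.iterate_add_apply, Function.iterate_add_apply]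
    linarith

lemma rat_tendsto (hmono : StrictMono F)
    (hint : ∀ (x : ℝ) (m : ℤ), F (x + m) = F x + m) {k : ℕ} {p : ℤ} {z : ℝ}
    (hz : F^[k] z = z + p) (x : ℝ) :
    ∃ l, Tendsto (fun n : ℕ => F^[k * n] x - ((n * p : ℤ) : ℝ)) atTop (nhds l) := by
  set G : ℝ → ℝ := fun a => F^[k] a - p with hG
  have hGm : Monotone G := fun a b hab => by
    have := (hmono.iterate k).monotone hab
    simp only [hG]; linarith
  have hit : ∀ (n : ℕ) a, G^[n] a = F^[k * n] a - ((n * p : ℤ) : ℝ) := by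
    intro n
    induction n with
    | zero => simp
    | succ n ih =>
      intro a
      rw [Function.iterate_succ_apply', ih]
      simp only [hG]
      rw [cl_iter_sub hint, ← Function.iterate_add_apply,
        show k * (n + 1) = k + k * n by ring]
      push_cast; ring
  have hfix : ∀ (m : ℤ) (n : ℕ), G^[n] (z + m) = z + m := by
    intro m n
    refine Function.iterate_fixed ?_ n
    simp only [hG]
    rw [cl_iter_int hint, hz]; ring
  simp only [← hit]
  rcases le_total x (G x) with h | h
  · refine ⟨_, tendsto_atTop_ciSup (hGm.monotone_iterate_of_le_map h)
      ⟨z + ⌈x - z⌉, ?_⟩⟩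
    rintro _ ⟨n, rfl⟩
    have := hGm.iterate n (show x ≤ z + ⌈x - z⌉ by linarith [Int.le_ceil (x - z)])
    rwa [hfix] at this
  · refine ⟨_, tendsto_atTop_ciInf (hGm.antitone_iterate_of_map_le h)
      ⟨z + ⌊x - z⌋, ?_⟩⟩
    rintro _ ⟨n, rfl⟩
    have := hGm.iterate n (show z + ⌊x - z⌋ ≤ x by linarith [Int.floor_le (x - z)])
    rwa [hfix] at this

end RealLine
section Circle

/-- The arc which is the image of `[a, b]`. -/
def arcS (a b : ℝ) : Set (AddCircle (1 : ℝ)) := (fun x : ℝ => (x : AddCircle (1 : ℝ))) '' Set.Icc a b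

lemma dist_coe_le (x y : ℝ) : dist (x : AddCircle (1 : ℝ)) (y : AddCircle (1 : ℝ)) ≤ |x - y| := by
  rw [dist_eq_norm, ← AddCircle.coe_sub]
  exact QuotientAddGroup.norm_mk_le_norm

lemma coe_sub_int (x : ℝ) (m : ℤ) : ((x - m : ℝ) : AddCircle (1 : ℝ)) = x := by
  rw [AddCircle.coe_sub, sub_eq_self, AddCircle.coe_eq_zero_iff]
  exact ⟨m, by simp⟩

lemma exists_dist_coe (x y : ℝ) : ∃ m : ℤ,
    dist (x : AddCircle (1 : ℝ)) (y : AddCircle (1 : ℝ)) = |x - (y + m)| := by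
  refine ⟨round (x - y), ?_⟩
  rw [dist_eq_norm, ← AddCircle.coe_sub, AddCircle.norm_eq]
  simp [sub_sub]

lemma arcS_sub_int (a b : ℝ) (m : ℤ) : arcS (a - m) (b - m) = arcS a b := by
  ext q
  constructor
  · rintro ⟨x, ⟨h1, h2⟩, rfl⟩
    refine ⟨x + m, ⟨by linarith, by linarith⟩, ?_⟩
    have := coe_sub_int (x + m) m
    simpa using this.symm
  · rintro ⟨x, ⟨h1, h2⟩, rfl⟩
    exact ⟨x - m, ⟨by linarith, by linarith⟩, coe_sub_int x m⟩

lemma arcS_near {a b c d : ℝ} (hcd : c ≤ d) :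
    ∀ x ∈ arcS a b, ∃ y ∈ arcS c d, dist x y ≤ max |a - c| |b - d| := by
  rintro _ ⟨x, ⟨h1, h2⟩, rfl⟩
  refine ⟨_, ⟨max c (min x d), ⟨le_max_left _ _, max_le hcd (min_le_right _ _)⟩, rfl⟩,
    (dist_coe_le _ _).trans ?_⟩
  rcases le_total x c with h | h
  · rw [min_eq_left (h.trans hcd), max_eq_left h]
    refine le_max_of_le_left ?_
    rw [abs_of_nonpos (by linarith), abs_of_nonpos (by linarith)]
    linarith
  · rcases le_total x d with h' | h'
    · rw [min_eq_left h', max_eq_right h]; simp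
    · rw [min_eq_right h', max_eq_right hcd]
      refine le_max_of_le_right ?_
      rw [abs_of_nonneg (by linarith), abs_of_nonneg (by linarith)]
      linarith

lemma hd_ne_top {s t : Set (AddCircle (1 : ℝ))} (hs : s.Nonempty) (ht : t.Nonempty) :
    Metric.hausdorffEDist s t ≠ ⊤ :=
  Metric.hausdorffEDist_ne_top_of_nonempty_of_bounded hs ht
    (Metric.isBounded_of_compactSpace) (Metric.isBounded_of_compactSpace)

lemma arcS_nonempty {a b : ℝ} (h : a ≤ b) : (arcS a b).Nonempty :=
  ⟨_, a, ⟨le_rfl, h⟩, rfl⟩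

lemma arcS_compact (a b : ℝ) : IsCompact (arcS a b) :=
  isCompact_Icc.image (AddCircle.continuous_mk' 1)

lemma arcS_hd {a b c d : ℝ} (hab : a ≤ b) (hcd : c ≤ d) :
    Metric.hausdorffDist (arcS a b) (arcS c d) ≤ max |a - c| |b - d| := by
  refine Metric.hausdorffDist_le_of_mem_dist (le_max_of_le_left (abs_nonneg _)) (arcS_near hcd) ?_
  rw [abs_sub_comm a, abs_sub_comm b]
  exact arcS_near hab

lemma subcont_arc (A : Set (AddCircle (1 : ℝ))) (hA : IsConnected A) (hAc : IsCompact A) :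
    ∃ a b : ℝ, a ≤ b ∧ b ≤ a + 1 ∧ A = arcS a b := by
  by_cases hu : A = Set.univ
  · refine ⟨0, 0 + 1, by norm_num, le_rfl, ?_⟩
    rw [hu]
    exact (AddCircle.coe_image_Icc_eq (1 : ℝ) 0).symm
  · obtain ⟨q, hq⟩ := (Set.ne_univ_iff_exists_notMem A).mp hu
    obtain ⟨t, rfl⟩ := QuotientAddGroup.mk_surjective q
    set e := AddCircle.openPartialHomeomorphCoe (1 : ℝ) t with he
    have hsub : A ⊆ e.target := by
      intro x hx
      change x ∈ ({(t : AddCircle (1 : ℝ))} : Set _)ᶜ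
      rintro rfl
      exact hq hx
    have hcont : ContinuousOn e.symm A := e.continuousOn_symm.mono hsub
    have h1 := eq_Icc_of_connected_compact (hA.image _ hcont) (hAc.image_of_continuousOn hcont)
    have hne := (hA.image _ hcont).nonempty
    set a := sInf (e.symm '' A)
    set b := sSup (e.symm '' A)
    have hab : a ≤ b := by rw [h1] at hne; exact Set.nonempty_Icc.mp hne
    have hsrc : ∀ x ∈ Set.Icc a b, x ∈ Set.Ioo t (t + 1) := by
      rw [← h1]
      rintro _ ⟨x, hx, rfl⟩
      exact e.map_target (hsub hx)
    refine ⟨a, b, hab, ?_, ?_⟩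
    · have ha := hsrc a ⟨le_rfl, hab⟩
      have hb := hsrc b ⟨hab, le_rfl⟩
      linarith [ha.1, hb.2]
    · rw [arcS, ← h1, Set.image_image]
      have : ∀ x ∈ A, ((e.symm x : ℝ) : AddCircle (1 : ℝ)) = x := fun x hx => e.right_inv (hsub hx)
      rw [Set.image_congr this, Set.image_id']

lemma gap_dist {a b1 b2 : ℝ} :
    ∀ y ∈ arcS b1 b2, min (a - b2) (b1 + 1 - a) ≤ dist (a : AddCircle (1 : ℝ)) y := by
  rintro _ ⟨y, ⟨h3, h4⟩, rfl⟩
  obtain ⟨m, hm⟩ := exists_dist_coe a y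
  simp only [hm]
  rcases le_or_gt m 0 with h | h
  · have : (m : ℝ) ≤ 0 := by exact_mod_cast h
    exact (min_le_left _ _).trans ((by linarith : _ ≤ a - (y + m)).trans (le_abs_self _))
  · have : (1 : ℝ) ≤ m := by exact_mod_cast h
    exact (min_le_right _ _).trans ((by linarith : _ ≤ -(a - (y + m))).trans (neg_le_abs _))

lemma coe_eq_exists {s t : ℝ} (h : (s : AddCircle (1 : ℝ)) = t) : ∃ m : ℤ, s = t - m := by
  have h' : ((t - s : ℝ) : AddCircle (1 : ℝ)) = 0 := by rw [AddCircle.coe_sub, h, sub_self]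
  obtain ⟨m, hm⟩ := (AddCircle.coe_eq_zero_iff (1 : ℝ)).mp h'
  refine ⟨m, ?_⟩
  simp at hm
  linarith

lemma iter_coe_mem {F : ℝ → ℝ} (hmono : StrictMono F)
    (hint : ∀ (x : ℝ) (m : ℤ), F (x + m) = F x + m) {a b t : ℝ}
    (h : (t : AddCircle (1 : ℝ)) ∈ arcS a b) (n : ℕ) :
    ((F^[n] t : ℝ) : AddCircle (1 : ℝ)) ∈ arcS (F^[n] a) (F^[n] b) := by
  obtain ⟨s, hs, hst⟩ := h
  obtain ⟨m, rfl⟩ := coe_eq_exists hst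
  refine ⟨F^[n] (t - m), ⟨(hmono.iterate n).monotone hs.1, (hmono.iterate n).monotone hs.2⟩, ?_⟩
  simp only [cl_iter_sub hint, coe_sub_int]

/-- One-sided convergence in the case without periodic points. -/
lemma irr_side {F : ℝ → ℝ} (hmono : StrictMono F) (hc : Continuous F)
    (hsurj : Function.Surjective F)
    (hint : ∀ (x : ℝ) (m : ℤ), F (x + m) = F x + m)
    (hnf : ∀ k : ℕ, 1 ≤ k → ∀ (p : ℤ) z, F^[k] z ≠ z + p)
    {a1 a2 b1 b2 : ℝ} (ha : a1 ≤ a2) (hb : b1 ≤ b2)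
    (hprox : ∀ ε > 0, ∃ᶠ n in atTop, Metric.hausdorffDist (arcS (F^[n] a1) (F^[n] a2))
      (arcS (F^[n] b1) (F^[n] b2)) < ε) (ε : ℝ) (hε : 0 < ε) :
    ∀ᶠ n in atTop, ∀ x ∈ arcS (F^[n] a1) (F^[n] a2), ∃ y ∈ arcS (F^[n] b1) (F^[n] b2),
      dist x y ≤ ε := by
  have hm : ∀ n, Monotone F^[n] := fun n => (hmono.iterate n).monotone
  have hone : ∀ n, F^[n] (b1 + 1) = F^[n] b1 + 1 := fun n => by
    simpa using cl_iter_int hint n b1 1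
  set T : Set ℝ := Set.Icc b2 (b1 + 1) ∩ (fun x : ℝ => (x : AddCircle (1 : ℝ))) ⁻¹' arcS a1 a2
    with hT
  have hTc : IsCompact T := isCompact_Icc.inter_right
    ((arcS_compact a1 a2).isClosed.preimage (AddCircle.continuous_mk' 1))
  have hdich : ∀ t ∈ T, Wand F b2 t ∨ Wand F t (b1 + 1) := by
    rintro t ⟨ht1, ht2⟩
    by_contra! hcon
    obtain ⟨δ, hδ, h1⟩ := not_wand_delta hmono hc hint hnf hcon.1
    obtain ⟨δ', hδ', h2⟩ := not_wand_delta hmono hc hint hnf hcon.2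
    obtain ⟨n, hn, h3, h4⟩ := ((hprox (min δ δ') (lt_min hδ hδ')).and_eventually (h1.and h2)).exists
    obtain ⟨y, hy, hd⟩ := Metric.exists_dist_lt_of_hausdorffDist_lt (iter_coe_mem hmono hint ht2 n)
      hn (hd_ne_top (arcS_nonempty (hm n ha)) (arcS_nonempty (hm n hb)))
    have h5 := gap_dist (a := F^[n] t) y hy
    rw [hone] at h4
    have := min_le_min h3 h4
    linarith
  have hL : ∀ᶠ n in atTop, ∀ t ∈ T, Wand F b2 t → F^[n] t - F^[n] b2 < ε := by
    by_cases hne : (T ∩ {t | Wand F b2 t}).Nonempty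
    · obtain ⟨s, hs, hmax⟩ := (hTc.inter_right (wand_closed_right hc b2)).exists_isGreatest hne
      filter_upwards [wand_tendsto hmono hint hs.2 ε hε] with n hn t ht hW
      have := hm n (hmax ⟨ht, hW⟩)
      linarith
    · exact Eventually.of_forall fun n t ht hW => absurd ⟨t, ht, hW⟩ hne
  have hR : ∀ᶠ n in atTop, ∀ t ∈ T, Wand F t (b1 + 1) → F^[n] b1 + 1 - F^[n] t < ε := by
    by_cases hne : (T ∩ {t | Wand F t (b1 + 1)}).Nonempty
    · obtain ⟨s, hs, hmin⟩ := (hTc.inter_right (wand_closed_left hc (b1 + 1))).exists_isLeast hne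
      filter_upwards [wand_tendsto hmono hint hs.2 ε hε] with n hn t ht hW
      have := hm n (hmin ⟨ht, hW⟩)
      rw [hone] at hn
      linarith
    · exact Eventually.of_forall fun n t ht hW => absurd ⟨t, ht, hW⟩ hne
  filter_upwards [hL, hR] with n h1 h2
  rintro _ ⟨x, hx, rfl⟩
  obtain ⟨s, rfl⟩ := hsurj.iterate n x
  have hs : s ∈ Set.Icc a1 a2 :=
    ⟨(hmono.iterate n).le_iff_le.mp hx.1, (hmono.iterate n).le_iff_le.mp hx.2⟩
  set t := s - ⌊s - b1⌋ with ht
  have hcoe : (t : AddCircle (1 : ℝ)) = s := coe_sub_int _ _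
  have hcoe' : ((F^[n] t : ℝ) : AddCircle (1 : ℝ)) = (F^[n] s : ℝ) := by
    rw [ht, cl_iter_sub hint, coe_sub_int]
  have hts : (t : AddCircle (1 : ℝ)) ∈ arcS a1 a2 := by rw [hcoe]; exact ⟨s, hs, rfl⟩
  have hb1 : b1 ≤ t := by linarith [Int.floor_le (s - b1)]
  have hb2 : t ≤ b1 + 1 := by linarith [Int.lt_floor_add_one (s - b1)]
  simp only [← hcoe']
  rcases le_total t b2 with h | h
  · exact ⟨_, ⟨F^[n] t, ⟨hm n hb1, hm n h⟩, rfl⟩, by simpa using hε.le⟩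
  · have htT : t ∈ T := ⟨⟨h, hb2⟩, hts⟩
    rcases hdich t htT with hW | hW
    · refine ⟨_, ⟨F^[n] b2, ⟨hm n hb, le_rfl⟩, rfl⟩, (dist_coe_le _ _).trans ?_⟩
      have := h1 t htT hW
      have h3 := hm n h
      rw [abs_of_nonneg (by linarith)]
      exact this.le
    · refine ⟨_, ⟨F^[n] b1, ⟨le_rfl, hm n hb⟩, rfl⟩, ?_⟩
      have := h2 t htT hW
      have h3 := hm n hb2
      rw [hone] at h3
      have h4 : ((F^[n] b1 : ℝ) : AddCircle (1 : ℝ)) = ((F^[n] b1 + 1 : ℝ) : AddCircle (1 : ℝ)) :=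
        (AddCircle.coe_add_period (1 : ℝ) _).symm
      simp only [h4]
      refine (dist_coe_le _ _).trans ?_
      rw [abs_of_nonpos (by linarith)]
      linarith

lemma irr_case {F : ℝ → ℝ} (hmono : StrictMono F) (hc : Continuous F)
    (hsurj : Function.Surjective F)
    (hint : ∀ (x : ℝ) (m : ℤ), F (x + m) = F x + m)
    (hnf : ∀ k : ℕ, 1 ≤ k → ∀ (p : ℤ) z, F^[k] z ≠ z + p)
    {a1 a2 b1 b2 : ℝ} (ha : a1 ≤ a2) (hb : b1 ≤ b2)
    (hprox : ∀ ε > 0, ∃ᶠ n in atTop, Metric.hausdorffDist (arcS (F^[n] a1) (F^[n] a2))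
      (arcS (F^[n] b1) (F^[n] b2)) < ε) (ε : ℝ) (hε : 0 < ε) :
    ∀ᶠ n in atTop, Metric.hausdorffDist (arcS (F^[n] a1) (F^[n] a2))
      (arcS (F^[n] b1) (F^[n] b2)) ≤ ε := by
  filter_upwards [irr_side hmono hc hsurj hint hnf ha hb hprox ε hε,
    irr_side hmono hc hsurj hint hnf hb ha
      (fun ε hε => by simpa only [Metric.hausdorffDist_comm] using hprox ε hε) ε hε] with n h1 h2
  exact Metric.hausdorffDist_le_of_mem_dist hε.le h1 h2

lemma rat_case {F : ℝ → ℝ} (hmono : StrictMono F) (hc : Continuous F)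
    (hint : ∀ (x : ℝ) (m : ℤ), F (x + m) = F x + m)
    (f : AddCircle (1 : ℝ) → AddCircle (1 : ℝ)) (hinj : Function.Injective f)
    (himg : ∀ (n : ℕ) (a b : ℝ), f^[n] '' arcS a b = arcS (F^[n] a) (F^[n] b))
    {k : ℕ} (hk : 1 ≤ k) {p : ℤ} {z : ℝ} (hz : F^[k] z = z + p)
    {a1 a2 b1 b2 : ℝ} (ha : a1 ≤ a2) (hb : b1 ≤ b2)
    (hprox : ∀ ε > 0, ∃ᶠ n in atTop, Metric.hausdorffDist (arcS (F^[n] a1) (F^[n] a2))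
      (arcS (F^[n] b1) (F^[n] b2)) < ε) (ε : ℝ) (hε : 0 < ε) :
    ∀ᶠ n in atTop, Metric.hausdorffDist (arcS (F^[n] a1) (F^[n] a2))
      (arcS (F^[n] b1) (F^[n] b2)) ≤ ε := by
  have hm : ∀ n, Monotone F^[n] := fun n => (hmono.iterate n).monotone
  have hlim := rat_tendsto hmono hint hz
  choose l hl using hlim
  have hlr : ∀ (r : ℕ) (x : ℝ),
      Tendsto (fun n : ℕ => F^[k * n + r] x - ((n * p : ℤ) : ℝ)) atTop (nhds (F^[r] (l x))) := by
    intro r x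
    have := ((hc.iterate r).tendsto (l x)).comp (hl x)
    refine this.congr fun n => ?_
    simp only [Function.comp_apply]
    rw [cl_iter_sub hint, ← Function.iterate_add_apply, add_comm]
  have hlm : Monotone l := fun x y hxy => le_of_tendsto_of_tendsto' (hl x) (hl y) fun n => by
    have := hm (k * n) hxy
    linarith
  set E : ℕ → ℝ := fun r => Metric.hausdorffDist (arcS (F^[r] (l a1)) (F^[r] (l a2)))
    (arcS (F^[r] (l b1)) (F^[r] (l b2))) with hE
  -- convergence of one arc
  have harc : ∀ (r : ℕ) (a b : ℝ), a ≤ b → ∀ η > 0, ∀ᶠ n : ℕ in atTop,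
      Metric.hausdorffDist (arcS (F^[k * n + r] a) (F^[k * n + r] b))
        (arcS (F^[r] (l a)) (F^[r] (l b))) < η := by
    intro r a b hab η hη
    filter_upwards [(Metric.tendsto_nhds.mp (hlr r a)) η hη,
      (Metric.tendsto_nhds.mp (hlr r b)) η hη] with n h1 h2
    rw [← arcS_sub_int (F^[k * n + r] a) (F^[k * n + r] b) (n * p)]
    refine (arcS_hd ?_ (hm r (hlm hab))).trans_lt (max_lt h1 h2)
    have := hm (k * n + r) hab
    linarith
  have hres : ∀ r : ℕ, ∀ η > 0, ∀ᶠ n : ℕ in atTop,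
      |Metric.hausdorffDist (arcS (F^[k * n + r] a1) (F^[k * n + r] a2))
        (arcS (F^[k * n + r] b1) (F^[k * n + r] b2)) - E r| < η := by
    intro r η hη
    filter_upwards [harc r a1 a2 ha (η / 2) (by linarith),
      harc r b1 b2 hb (η / 2) (by linarith)] with n h1 h2
    have nA := arcS_nonempty (hm (k * n + r) ha)
    have nB := arcS_nonempty (hm (k * n + r) hb)
    have nA' := arcS_nonempty (hm r (hlm ha))
    have nB' := arcS_nonempty (hm r (hlm hb))
    have t1 := Metric.hausdorffDist_triangle (u := arcS (F^[k * n + r] b1) (F^[k * n + r] b2))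
      (hd_ne_top nA nA')
    have t2 := Metric.hausdorffDist_triangle (u := arcS (F^[k * n + r] b1) (F^[k * n + r] b2))
      (hd_ne_top nA' nB')
    have t3 := Metric.hausdorffDist_triangle (u := arcS (F^[r] (l b1)) (F^[r] (l b2)))
      (hd_ne_top nA' nA)
    have t4 := Metric.hausdorffDist_triangle (u := arcS (F^[r] (l b1)) (F^[r] (l b2)))
      (hd_ne_top nA nB)
    rw [Metric.hausdorffDist_comm (s := arcS (F^[r] (l b1)) (F^[r] (l b2)))] at t2
    rw [Metric.hausdorffDist_comm (s := arcS (F^[r] (l a1)) (F^[r] (l a2)))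
      (t := arcS (F^[k * n + r] a1) (F^[k * n + r] a2))] at t3
    simp only [hE]
    rw [abs_lt]
    constructor <;> linarith
  -- reassembling residues
  have hall : ∀ P : ℕ → Prop, (∀ r, ∀ᶠ n : ℕ in atTop, P (k * n + r)) → ∀ᶠ n in atTop, P n := by
    intro P hP
    have h1 : ∀ᶠ n : ℕ in atTop, ∀ r ∈ Finset.range k, P (k * n + r) :=
      (eventually_all_finset _).mpr fun r _ => hP r
    have h2 := (Nat.tendsto_div_const_atTop (n := k) (by omega)).eventually h1
    filter_upwards [h2] with n hn
    have := hn (n % k) (Finset.mem_range.mpr (Nat.mod_lt _ (by omega)))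
    rwa [Nat.div_add_mod] at this
  by_cases hzero : ∃ r, E r = 0
  · obtain ⟨r, hr⟩ := hzero
    have heq : arcS (F^[r] (l a1)) (F^[r] (l a2)) = arcS (F^[r] (l b1)) (F^[r] (l b2)) :=
      ((arcS_compact _ _).isClosed.hausdorffDist_zero_iff_eq (arcS_compact _ _).isClosed
        (hd_ne_top (arcS_nonempty (hm r (hlm ha))) (arcS_nonempty (hm r (hlm hb))))).mp hr
    rw [← himg, ← himg] at heq
    have heq0 := (hinj.iterate r).image_injective heq
    have hE0 : ∀ s, E s = 0 := by
      intro s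
      simp only [hE]
      rw [← himg, ← himg, heq0]
      exact Metric.hausdorffDist_self_zero
    refine hall _ fun r => ?_
    filter_upwards [hres r ε hε] with n hn
    rw [hE0, sub_zero] at hn
    exact (le_abs_self _).trans hn.le
  · exfalso
    push Not at hzero
    have hpos : ∀ r, 0 < E r := fun r =>
      lt_of_le_of_ne Metric.hausdorffDist_nonneg (Ne.symm (hzero r))
    obtain ⟨r0, -, hr0⟩ := (Finset.range k).exists_min_image E ⟨0, by simp; omega⟩
    have h1 : ∀ᶠ n in atTop, E r0 / 2 ≤ Metric.hausdorffDist (arcS (F^[n] a1) (F^[n] a2))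
      (arcS (F^[n] b1) (F^[n] b2)) := by
      have h2 : ∀ᶠ n : ℕ in atTop, ∀ r ∈ Finset.range k, E r0 / 2 ≤
          Metric.hausdorffDist (arcS (F^[k * n + r] a1) (F^[k * n + r] a2))
            (arcS (F^[k * n + r] b1) (F^[k * n + r] b2)) := by
        refine (eventually_all_finset _).mpr fun r hr => ?_
        filter_upwards [hres r (E r0 / 2) (by linarith [hpos r0])] with n hn
        have := hr0 r hr
        rw [abs_lt] at hn
        linarith
      have h3 := (Nat.tendsto_div_const_atTop (n := k) (by omega)).eventually h2
      filter_upwards [h3] with n hn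
      have := hn (n % k) (Finset.mem_range.mpr (Nat.mod_lt _ (by omega)))
      rwa [Nat.div_add_mod] at this
    obtain ⟨n, hn, hn'⟩ := ((hprox (E r0 / 2) (by linarith [hpos r0])).and_eventually h1).exists
    linarith

lemma inducedC_iter (f : AddCircle (1 : ℝ) → AddCircle (1 : ℝ)) (hf : Continuous f)
    (A : Subcontinua (AddCircle (1 : ℝ))) (n : ℕ) :
    ((((inducedC f hf)^[n] A).1 : NonemptyCompacts _) : Set (AddCircle (1 : ℝ)))
      = f^[n] '' (A.1 : Set (AddCircle (1 : ℝ))) := by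
  induction n with
  | zero => simp
  | succ n ih =>
    rw [Function.iterate_succ_apply', Function.iterate_succ', Set.image_comp, ← ih]
    rfl

end Circle

/-- If `f` is an orientation-preserving homeomorphism of the circle (it lifts to a strictly
monotone degree-one map of the line), then the induced map `C(f)` on the hyperspace of
subcontinua of the circle has no Li–Yorke pair. -/
theorem circle_inducedC_no_LiYorke (f : AddCircle (1 : ℝ) ≃ₜ AddCircle (1 : ℝ))
    (F : ℝ → ℝ) (hmono : StrictMono F) (hdeg : ∀ x : ℝ, F (x + 1) = F x + 1)
    (hlift : ∀ x : ℝ, f (x : AddCircle (1 : ℝ)) = ((F x : ℝ) : AddCircle (1 : ℝ))) :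
    ∀ A B : Subcontinua (AddCircle (1 : ℝ)),
      ¬ LiYorke (inducedC (⇑f) f.continuous) A B := by
  rintro A B ⟨hprox, hnas⟩
  apply hnas
  have hint := cl_int hdeg
  have hsurj : Function.Surjective F := by
    intro y
    obtain ⟨q, hq⟩ := f.surjective (y : AddCircle (1 : ℝ))
    obtain ⟨x, rfl⟩ := QuotientAddGroup.mk_surjective q
    have h1 : ((F x : ℝ) : AddCircle (1 : ℝ)) = y := by rw [← hlift]; exact hq
    obtain ⟨m, hm⟩ := coe_eq_exists h1
    exact ⟨x + m, by rw [hint, hm]; ring⟩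
  have hc : Continuous F := hmono.monotone.continuous_of_surjective hsurj
  have hiter : ∀ (n : ℕ) (x : ℝ), f^[n] (x : AddCircle (1 : ℝ)) = ((F^[n] x : ℝ) : AddCircle (1 : ℝ)) := by
    intro n
    induction n with
    | zero => simp
    | succ n ih => intro x; rw [Function.iterate_succ_apply, Function.iterate_succ_apply, hlift, ih]
  have himg : ∀ (n : ℕ) (a b : ℝ), f^[n] '' arcS a b = arcS (F^[n] a) (F^[n] b) := by
    intro n a b
    have h := ((hmono.iterate n).orderIsoOfSurjective _ (hsurj.iterate n)).image_Icc a b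
    simp only [StrictMono.coe_orderIsoOfSurjective] at h
    rw [arcS, arcS, ← h, Set.image_image, Set.image_image]
    exact Set.image_congr fun x _ => hiter n x
  obtain ⟨a1, a2, ha, -, hA⟩ := subcont_arc A.1 A.2 A.1.isCompact
  obtain ⟨b1, b2, hb, -, hB⟩ := subcont_arc B.1 B.2 B.1.isCompact
  have hu : ∀ n : ℕ, dist ((inducedC (⇑f) f.continuous)^[n] A) ((inducedC (⇑f) f.continuous)^[n] B)
      = Metric.hausdorffDist (arcS (F^[n] a1) (F^[n] a2)) (arcS (F^[n] b1) (F^[n] b2)) := by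
    intro n
    rw [Subtype.dist_eq, Metric.NonemptyCompacts.dist_eq, inducedC_iter, inducedC_iter, hA, hB,
      himg, himg]
  have hm : ∀ n, Monotone F^[n] := fun n => (hmono.iterate n).monotone
  unfold Proximal at hprox
  unfold Asymptotic
  simp only [hu] at hprox ⊢
  set u : ℕ → ℝ := fun n =>
    Metric.hausdorffDist (arcS (F^[n] a1) (F^[n] a2)) (arcS (F^[n] b1) (F^[n] b2)) with hudef
  have hd1 : ∀ x y : AddCircle (1 : ℝ), dist x y ≤ 1 := by
    intro x y
    rw [dist_eq_norm]
    have := AddCircle.norm_le_half_period (1 : ℝ) (x := x - y) one_ne_zero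
    norm_num at this
    linarith
  have hu1 : ∀ n, u n ≤ 1 := by
    intro n
    obtain ⟨x0, hx0⟩ := arcS_nonempty (hm n ha)
    obtain ⟨y0, hy0⟩ := arcS_nonempty (hm n hb)
    exact Metric.hausdorffDist_le_of_mem_dist zero_le_one (fun x _ => ⟨y0, hy0, hd1 _ _⟩)
      (fun x _ => ⟨x0, hx0, hd1 _ _⟩)
  have hfreq : ∀ ε > 0, ∃ᶠ n in atTop, u n < ε := by
    intro ε hε
    by_contra hcon
    have hev : ∀ᶠ n in atTop, ε ≤ u n := by simpa [Filter.not_frequently] using hcon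
    have := le_liminf_of_le (f := atTop) (u := u)
      (isBoundedUnder_of ⟨1, hu1⟩ : IsBoundedUnder (· ≤ ·) atTop u).isCoboundedUnder_ge hev
    linarith
  have hev : ∀ ε > 0, ∀ᶠ n in atTop, u n ≤ ε := by
    intro ε hε
    by_cases hper : ∀ k : ℕ, 1 ≤ k → ∀ (p : ℤ) z, F^[k] z ≠ z + p
    · exact irr_case hmono hc hsurj hint hper ha hb hfreq ε hε
    · push Not at hper
      obtain ⟨k, hk, p, z, hz⟩ := hper
      exact rat_case hmono hc hint f f.injective himg hk hz ha hb hfreq ε hε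
  have htend : Tendsto u atTop (nhds 0) := by
    rw [Metric.tendsto_nhds]
    intro ε hε
    filter_upwards [hev (ε / 2) (by linarith)] with n hn
    rw [Real.dist_eq, sub_zero, abs_of_nonneg Metric.hausdorffDist_nonneg]
    linarith
  exact htend.limsup_eq
end

section
/- Let f : X → X be a homeomorphism of a regular curve. If Ω(f) = X, then h_top(2^f) = 0; if Ω(f) ≠ X, then h_top(2^f) = +∞. In particular h_top(2^f) ∈ {0, +∞}. -/
open TopologicalSpace

/-- The induced map on the hyperspace of nonempty compact subsets, `A ↦ f(A)`. -/
noncomputable def inducedHyper {X : Type*} [MetricSpace X] (f : X → X) (hf : Continuous f) :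
    NonemptyCompacts X → NonemptyCompacts X :=
  fun A => ⟨⟨f '' (A : Set X), A.isCompact.image hf⟩, A.nonempty.image f⟩

/-- The set of nonwandering points of `f`. -/
def nonwandering {X : Type*} [TopologicalSpace X] (f : X → X) : Set X :=
  {x : X | ∀ U ∈ nhds x, ∃ n : ℕ, 0 < n ∧ ((f^[n] ⁻¹' U) ∩ U).Nonempty}



/-- Regularity of the curve. -/
def RegCurve (X : Type*) [MetricSpace X] : Prop :=
  ∀ x : X, ∀ ε > (0 : ℝ), ∃ U : Set X,
      IsOpen U ∧ x ∈ U ∧ U ⊆ Metric.ball x ε ∧ (frontier U).Finite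

theorem crossing {X : Type*} [TopologicalSpace X] {A G : Set X} (hA : IsPreconnected A)
    (hG : IsOpen G) {a b : X} (ha : a ∈ A) (haG : a ∈ G) (hb : b ∈ A) (hbG : b ∉ G) :
    ∃ p ∈ A, p ∈ frontier G := by
  by_contra hcon
  push Not at hcon
  have hsub : A ⊆ G ∪ (closure G)ᶜ := by
    intro y hy
    by_cases h : y ∈ G
    · exact Or.inl h
    · right
      intro h2
      apply hcon y hy
      rw [frontier, hG.interior_eq]
      exact ⟨h2, h⟩
  have hbc : b ∈ (closure G)ᶜ := (hsub hb).resolve_left hbG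
  obtain ⟨y, _, hy1, hy2⟩ := hA G (closure G)ᶜ hG isClosed_closure.isOpen_compl hsub
    ⟨a, ha, haG⟩ ⟨b, hb, hbc⟩
  exact hy2 (subset_closure hy1)

theorem reg_nhds {X : Type*} [MetricSpace X] (hreg : RegCurve X) (x : X) (W : Set X)
    (hW : W ∈ nhds x) : ∃ U : Set X, IsOpen U ∧ x ∈ U ∧ closure U ⊆ W ∧ (frontier U).Finite := by
  obtain ⟨ε, hε, hsub⟩ := Metric.mem_nhds_iff.1 hW
  obtain ⟨U, hU, hxU, hUb, hfin⟩ := hreg x (ε / 2) (by positivity)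
  refine ⟨U, hU, hxU, ?_, hfin⟩
  calc closure U ⊆ closure (Metric.ball x (ε/2)) := closure_mono hUb
    _ ⊆ Metric.closedBall x (ε/2) := Metric.closure_ball_subset_closedBall
    _ ⊆ Metric.ball x ε := Metric.closedBall_subset_ball (by linarith)
    _ ⊆ W := hsub

theorem loc_conn {X : Type*} [MetricSpace X] [ConnectedSpace X] (hreg : RegCurve X) (x : X)
    (W : Set X) (hW : W ∈ nhds x) : ∃ V ∈ nhds x, V ⊆ W ∧ IsPreconnected V := by
  obtain ⟨U, hU, hxU, hUW, hfin⟩ := reg_nhds hreg x W hW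
  set K := closure U with hK
  set F := frontier U with hF
  have hUK : U ⊆ K := subset_closure
  have hKF : ∀ y ∈ K, y ∉ F → y ∈ U := by
    intro y hy hyF
    by_contra h
    apply hyF
    rw [hF, frontier, hU.interior_eq]
    exact ⟨hy, h⟩
  let P : ℕ → Prop := fun n => ∃ Q : Set X, x ∈ Q ∧ Q ⊆ K ∧ IsClosed Q ∧ IsClosed (K \ Q) ∧
    (Q ∩ F).ncard = n
  have hex : ∃ n, P n := ⟨_, K, hUK hxU, subset_rfl, isClosed_closure, by simp, rfl⟩
  classical
  obtain ⟨Q, hxQ, hQK, hQc, hKQ, hcard⟩ := Nat.find_spec hex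
  have hmin : ∀ Q' : Set X, x ∈ Q' → Q' ⊆ K → IsClosed Q' → IsClosed (K \ Q') →
      (Q ∩ F).ncard ≤ (Q' ∩ F).ncard := by
    intro Q' h1 h2 h3 h4
    rw [hcard]
    exact Nat.find_min' hex ⟨Q', h1, h2, h3, h4, rfl⟩
  have key : ∀ t t' : Set X, IsClosed t → IsClosed t' → Q ⊆ t ∪ t' → x ∈ t →
      (Q ∩ t').Nonempty → (Q ∩ (t ∩ t')).Nonempty := by
    intro t t' ht ht' hsub hxt hne
    by_contra hemp
    have hdis : ∀ y ∈ Q, y ∈ t → y ∉ t' := fun y h1 h2 h3 => hemp ⟨y, h1, h2, h3⟩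
    have h1 : K \ (Q ∩ t) = (K \ Q) ∪ (Q ∩ t') := by
      ext y
      constructor
      · rintro ⟨hyK, hy⟩
        by_cases hyQ : y ∈ Q
        · rcases hsub hyQ with h | h
          · exact absurd ⟨hyQ, h⟩ hy
          · exact Or.inr ⟨hyQ, h⟩
        · exact Or.inl ⟨hyK, hyQ⟩
      · rintro (⟨h, h'⟩ | ⟨h, h'⟩)
        · exact ⟨h, fun h2 => h' h2.1⟩
        · exact ⟨hQK h, fun h2 => hdis y h h2.2 h'⟩
    have hle := hmin (Q ∩ t) ⟨hxQ, hxt⟩ (fun y hy => hQK hy.1) (hQc.inter ht)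
      (by rw [h1]; exact hKQ.union (hQc.inter ht'))
    have heq : (Q ∩ t) ∩ F = Q ∩ F := by
      apply Set.eq_of_subset_of_ncard_le _ hle (hfin.subset Set.inter_subset_right)
      intro y hy
      exact ⟨hy.1.1, hy.2⟩
    have hQ2F : ∀ y ∈ Q, y ∈ t' → y ∉ F := by
      intro y hy hyt hyF
      have : y ∈ (Q ∩ t) ∩ F := by rw [heq]; exact ⟨hy, hyF⟩
      exact hdis y hy this.1.2 hyt
    have hopen : IsOpen (Q ∩ t') := by
      have : Q ∩ t' = U \ ((K \ Q) ∪ (Q ∩ t)) := by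
        ext y
        constructor
        · rintro ⟨h, h'⟩
          refine ⟨hKF y (hQK h) (hQ2F y h h'), ?_⟩
          rintro (h2 | h2)
          · exact h2.2 h
          · exact hdis y h h2.2 h'
        · rintro ⟨h, h'⟩
          by_cases hyQ : y ∈ Q
          · rcases hsub hyQ with h3 | h3
            · exact absurd (Or.inr ⟨hyQ, h3⟩) h'
            · exact ⟨hyQ, h3⟩
          · exact absurd (Or.inl ⟨hUK h, hyQ⟩) h'
      rw [this]
      exact hU.sdiff (hKQ.union (hQc.inter ht))
    have huniv := IsClopen.eq_univ ⟨hQc.inter ht', hopen⟩ hne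
    have : x ∈ Q ∩ t' := by rw [huniv]; trivial
    exact hdis x hxQ hxt this.2
  refine ⟨Q, ?_, hQK.trans hUW, ?_⟩
  · refine Filter.mem_of_superset ((hU.sdiff hKQ).mem_nhds ⟨hxU, fun h => h.2 hxQ⟩) ?_
    rintro y ⟨h, h'⟩
    by_contra hyQ
    exact h' ⟨hUK h, hyQ⟩
  · rw [isPreconnected_closed_iff]
    intro t t' ht ht' hsub h1 h2
    rcases hsub hxQ with h | h
    · exact key t t' ht ht' hsub h h2
    · rw [Set.inter_comm t t']
      exact key t' t ht' ht (by rwa [Set.union_comm]) h h1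

theorem fin_net {X : Type*} [MetricSpace X] [CompactSpace X] (hreg : RegCurve X) (ε : ℝ)
    (hε : 0 < ε) : ∃ F : Finset X, ∀ A : Set X, IsPreconnected A → ∀ a ∈ A, ∀ b ∈ A,
      ε ≤ dist a b → ∃ p ∈ A, p ∈ F ∧ dist a p < ε := by
  classical
  have h := fun x : X => reg_nhds hreg x (Metric.ball x (ε / 2))
    (Metric.ball_mem_nhds x (by positivity))
  choose U hU hxU hUW hfin using h
  obtain ⟨t, ht⟩ := isCompact_univ.elim_finite_subcover U hU
    (fun x _ => Set.mem_iUnion.2 ⟨x, hxU x⟩)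
  refine ⟨t.biUnion fun x => (hfin x).toFinset, ?_⟩
  intro A hA a ha b hb hab
  obtain ⟨x, hx⟩ := Set.mem_iUnion.1 (ht (Set.mem_univ a))
  obtain ⟨hxt, hax⟩ := Set.mem_iUnion.1 hx
  have hac := hUW x (subset_closure hax)
  have hbU : b ∉ U x := by
    intro hbx
    have := hUW x (subset_closure hbx)
    rw [Metric.mem_ball] at *
    have := dist_triangle_right a b x
    linarith
  obtain ⟨p, hpA, hpF⟩ := crossing hA (hU x) ha hax hb hbU
  refine ⟨p, hpA, ?_, ?_⟩
  · rw [Finset.mem_biUnion]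
    exact ⟨x, hxt, by simpa using hpF⟩
  · have := hUW x (frontier_subset_closure hpF)
    rw [Metric.mem_ball] at *
    have := dist_triangle_right a p x
    linarith


/-- A continuous action of the integers, written as a family of maps. -/
structure ZAct {X : Type*} [TopologicalSpace X] (T : ℤ → X → X) : Prop where
  zero : ∀ x, T 0 x = x
  add : ∀ m n x, T (m + n) x = T m (T n x)
  cont : ∀ n, Continuous (T n)

/-- A point that is not periodic. -/
def NonPer {X : Type*} (T : ℤ → X → X) (x : X) : Prop := ∀ p : ℤ, p ≠ 0 → T p x ≠ x

section basics
variable {X : Type*} [TopologicalSpace X] {T : ℤ → X → X}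

theorem ZAct.comp_eq (hT : ZAct T) {a b c : ℤ} (h : a + b = c) (x : X) : T a (T b x) = T c x := by
  rw [← h, hT.add]

theorem ZAct.cancel (hT : ZAct T) (n : ℤ) (x : X) : T (-n) (T n x) = x := by
  rw [hT.comp_eq (c := 0) (by ring), hT.zero]

theorem ZAct.cancel' (hT : ZAct T) (n : ℤ) (x : X) : T n (T (-n) x) = x := by
  rw [hT.comp_eq (c := 0) (by ring), hT.zero]

theorem ZAct.inj (hT : ZAct T) (n : ℤ) {x y : X} (h : T n x = T n y) : x = y := by
  rw [← hT.cancel n x, h, hT.cancel]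

theorem ZAct.eq_iff (hT : ZAct T) {a b : ℤ} {x y : X} (h : T a x = T b y) (c : ℤ) :
    T (c + a) x = T (c + b) y := by
  rw [hT.add, hT.add, h]

theorem ZAct.rev (hT : ZAct T) : ZAct (fun n => T (-n)) where
  zero x := by simpa using hT.zero x
  add m n x := by
    have := hT.add (-m) (-n) x
    rw [← this]
    congr 1
    ring
  cont n := hT.cont _

theorem NonPer.rev {X : Type*} {T : ℤ → X → X} {x : X} (h : NonPer T x) : NonPer (fun n => T (-n)) x := by
  intro p hp
  exact h (-p) (by simpa using hp)

theorem NonPer.ne (hT : ZAct T) {x : X} (h : NonPer T x) {a b : ℤ} (hab : a ≠ b) :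
    T a x ≠ T b x := by
  intro h2
  apply h (-b + a) (by intro h3; apply hab; linarith)
  rw [hT.add, h2, hT.cancel]

theorem NonPer.map (hT : ZAct T) {x : X} (h : NonPer T x) (n : ℤ) : NonPer T (T n x) := by
  intro p hp h2
  rw [← hT.add] at h2
  exact h.ne hT (a := p + n) (b := n) (by intro h3; apply hp; linarith) h2

theorem ZAct.preim_nhds (hT : ZAct T) (n : ℤ) (x : X) {U : Set X} (hU : U ∈ nhds (T n x)) :
    T n ⁻¹' U ∈ nhds x := (hT.cont n).continuousAt.preimage_mem_nhds hU

end basics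

theorem count0 {X : Type*} [MetricSpace X] {T : ℤ → X → X} (hT : ZAct T) (F : Finset X)
    (S : Finset ℤ) (hS : F.card < S.card) (x : X) (hx : NonPer T x) :
    ∃ W ∈ nhds x, ∀ n : ℤ, ∃ v ∈ S, ∀ y ∈ W, T (n + v) y ∉ F := by
  classical
  obtain ⟨U, hU, hdis⟩ := ((S.finite_toSet).image (fun v => T v x)).t2_separation
  refine ⟨⋂ v ∈ S, T v ⁻¹' U (T v x), ?_, ?_⟩
  · rw [Filter.biInter_finset_mem]
    intro v _
    exact hT.preim_nhds v x ((hU _).2.mem_nhds (hU _).1)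
  · intro n
    by_contra hcon
    push Not at hcon
    have : Nonempty X := ⟨x⟩
    choose! y hyW hyF using hcon
    obtain ⟨v, hv, w, hw, hvw, heq⟩ := Finset.exists_ne_map_eq_of_card_lt_of_maps_to hS
      (f := fun v => T (n + v) (y v)) (fun v hv => hyF v hv)
    have h1 : T v (y v) = T w (y w) := by
      simp only [hT.add] at heq
      exact hT.inj n heq
    have h2 : T v (y v) ∈ U (T v x) := (Set.mem_iInter₂.1 (hyW v hv)) v hv
    have h3 : T w (y w) ∈ U (T w x) := (Set.mem_iInter₂.1 (hyW w hw)) w hw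
    have h4 := hdis ⟨v, hv, rfl⟩ ⟨w, hw, rfl⟩ (hx.ne hT hvw)
    rw [h1] at h2
    exact Set.disjoint_left.1 h4 h2 h3

theorem pigeon {ι κ : Type*} (I : Set ι) (hI : I.Infinite) (S : Finset κ) (R : ι → κ → Prop)
    (h : ∀ l ∈ I, ∃ v ∈ S, R l v) : ∃ v ∈ S, {l ∈ I | R l v}.Infinite := by
  by_contra hcon
  push Not at hcon
  apply hI
  refine (S.finite_toSet.biUnion (t := fun v => {l ∈ I | R l v}) ?_).subset ?_
  · intro v hv
    exact hcon v hv
  · intro l hl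
    obtain ⟨v, hv, hr⟩ := h l hl
    exact Set.mem_biUnion hv ⟨hl, hr⟩

theorem inf_large {I : Set ℕ} (hI : I.Infinite) {p : ℕ → Prop} (N : ℕ) (hp : ∀ k ≥ N, p k) :
    {k ∈ I | p k}.Infinite := by
  intro hfin
  apply hI
  refine (hfin.union (Set.finite_lt_nat N)).subset ?_
  intro k hk
  by_cases h : N ≤ k
  · exact Or.inl ⟨hk, hp k h⟩
  · exact Or.inr (by simpa using h)

/-- A shrinking sequence of connected neighbourhoods. -/
structure ShrinkSeq {X : Type*} [MetricSpace X] (x : X) (V : ℕ → Set X) : Prop where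
  nhd : ∀ k, V k ∈ nhds x
  conn : ∀ k, IsPreconnected (V k)
  small : ∀ W ∈ nhds x, ∃ N, ∀ k ≥ N, V k ⊆ W

theorem shrink_exists {X : Type*} [MetricSpace X] [ConnectedSpace X] (hreg : RegCurve X) (x : X) :
    ∃ V, ShrinkSeq x V := by
  have h := fun k : ℕ => loc_conn hreg x (Metric.ball x (1 / ((k : ℝ) + 1)))
    (Metric.ball_mem_nhds x (by positivity))
  choose V hV hVs hVc using h
  refine ⟨V, hV, hVc, ?_⟩
  intro W hW
  obtain ⟨ε, hε, hsub⟩ := Metric.mem_nhds_iff.1 hW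
  obtain ⟨N, hN⟩ := exists_nat_one_div_lt hε
  refine ⟨N, fun k hk => ((hVs k).trans (Metric.ball_subset_ball ?_)).trans hsub⟩
  refine le_trans ?_ hN.le
  apply one_div_le_one_div_of_le (by positivity)
  have : (N : ℝ) ≤ k := by exact_mod_cast hk
  linarith

theorem small_of_avoid {X : Type*} [MetricSpace X] {F : Finset X} {ε : ℝ}
    (hF : ∀ A : Set X, IsPreconnected A → ∀ a ∈ A, ∀ b ∈ A,
      ε ≤ dist a b → ∃ p ∈ A, p ∈ F ∧ dist a p < ε) {V : Set X} (hV : IsPreconnected V)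
    {g : X → X} (hg : Continuous g) (hav : ∀ y ∈ V, g y ∉ F) {a b : X} (ha : a ∈ V) (hb : b ∈ V) :
    dist (g a) (g b) < ε := by
  by_contra h
  push Not at h
  obtain ⟨p, ⟨y, hy, rfl⟩, hpF, _⟩ := hF (g '' V) (hV.image g hg.continuousOn) (g a) ⟨a, ha, rfl⟩
    (g b) ⟨b, hb, rfl⟩ h
  exact hav y hy hpF

theorem lemmaL {X : Type*} [MetricSpace X] [CompactSpace X] [ConnectedSpace X]
    (hreg : RegCurve X) {T : ℤ → X → X} (hT : ZAct T) (z : X) (hz : NonPer T z) (δ : ℝ)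
    (hδ : 0 < δ) : ∃ V ∈ nhds z, ∀ m : ℤ, ∀ u ∈ V, T m u ∈ V →
      dist (T m z) z < δ ∨ dist (T (-m) z) z < δ := by
  classical
  by_contra hcon
  push Not at hcon
  obtain ⟨V, hV⟩ := shrink_exists hreg z
  have h := fun k => hcon (V k) (hV.nhd k)
  choose m u hu hmu hm1 hm2 using h
  obtain ⟨F, hF⟩ := fin_net hreg (δ / 3) (by positivity)
  have hz3 : Metric.ball z (δ / 3) ∈ nhds z := Metric.ball_mem_nhds z (by positivity)
  have hzV : ∀ k, z ∈ V k := fun k => mem_of_mem_nhds (hV.nhd k)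
  -- images of infinite sets under `m` are infinite
  have hminf : ∀ I : Set ℕ, I.Infinite → (m '' I).Infinite := by
    intro I hI hfin
    obtain ⟨c, _, hc⟩ := pigeon I hI hfin.toFinset (fun l v => m l = v)
      (fun l hl => ⟨m l, by simpa using ⟨l, hl, rfl⟩, rfl⟩)
    have hne : T c z ≠ z := by
      obtain ⟨l, _, hl⟩ := hc.nonempty
      intro h2
      have := hm1 l
      rw [hl, h2, dist_self] at this
      linarith
    obtain ⟨O1, O2, hO1, hO2, h1, h2, hd⟩ := t2_separation hne
    obtain ⟨N, hN⟩ := hV.small (O2 ∩ T c ⁻¹' O1)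
      (Filter.inter_mem (hO2.mem_nhds h2) (hT.preim_nhds c z (hO1.mem_nhds h1)))
    obtain ⟨l, ⟨_, hl⟩, hlN⟩ := (inf_large hc (p := fun k => N ≤ k) N (fun k hk => hk)).nonempty
    have h3 := (hN l hlN (hu l)).2
    have h4 := (hN l hlN (hmu l)).1
    rw [hl] at h4
    exact Set.disjoint_left.1 hd h3 h4
  -- the step
  have step : ∀ I : Set ℕ, I.Infinite → ∃ k ∈ I, ∃ I' ⊆ I, I'.Infinite ∧
      ∀ l ∈ I', Disjoint (T (m k) '' V k) (T (m l) '' V l) := by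
    intro I hI
    obtain ⟨N0, hN0⟩ := hV.small _ hz3
    have hI0 := inf_large hI N0 hN0
    obtain ⟨S', hS'sub, hS'card⟩ := (hminf _ hI0).exists_subset_card_eq (F.card + 1)
    obtain ⟨W, hW, hWprop⟩ := count0 hT F (S'.image (fun v => -v))
      (by rw [Finset.card_image_of_injective _ neg_injective, hS'card]; exact Nat.lt_succ_self _)
      z hz
    have hW' : W ∩ ⋂ v ∈ S', T (-v) ⁻¹' Metric.ball (T (-v) z) (δ / 3) ∈ nhds z := by
      refine Filter.inter_mem hW ?_
      rw [Filter.biInter_finset_mem]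
      intro v _
      exact hT.preim_nhds _ _ (Metric.ball_mem_nhds _ (by positivity))
    obtain ⟨N1, hN1⟩ := hV.small _ hW'
    have hI1 := inf_large hI N1 hN1
    obtain ⟨v, hvS, hinf⟩ := pigeon _ hI1 S' (fun l v => ∀ y ∈ V l, T (m l + -v) y ∉ F) (by
      rintro l ⟨_, hl⟩
      obtain ⟨v, hv, hprop⟩ := hWprop (m l)
      obtain ⟨v', hv', rfl⟩ := Finset.mem_image.1 hv
      exact ⟨v', hv', fun y hy => hprop y (hl hy).1⟩)
    obtain ⟨k, ⟨hkI, hkV⟩, hkv⟩ := hS'sub hvS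
    refine ⟨k, hkI, _, ?_, hinf, ?_⟩
    · rintro l ⟨⟨hl, _⟩, _⟩
      exact hl
    · rintro l ⟨⟨hlI, hlV⟩, hlF⟩
      rw [Set.disjoint_left]
      rintro _ ⟨a, ha, rfl⟩ ⟨c, hc, hac⟩
      have e1 : T (m l + -v) c = a := by
        rw [add_comm, hT.add, hac, ← hkv, hT.cancel]
      have e2 : T (m l + -v) (u l) = T (-v) (T (m l) (u l)) := by
        rw [add_comm, hT.add]
      have d1 := small_of_avoid hF (hV.conn l) (hT.cont (m l + -v)) hlF (hu l) hc
      rw [e1, e2] at d1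
      have d2 : dist a z < δ / 3 := hkV ha
      have d3 : dist (T (-v) (T (m l) (u l))) (T (-v) z) < δ / 3 :=
        Set.mem_iInter₂.1 (hlV (hmu l)).2 v hvS
      have d4 := hm2 k
      rw [hkv] at d4
      have t1 := dist_triangle (T (-v) z) (T (-v) (T (m l) (u l))) z
      have t2 := dist_triangle (T (-v) (T (m l) (u l))) a z
      rw [dist_comm (T (-v) (T (m l) (u l))) (T (-v) z)] at d3
      linarith
  have iter : ∀ Q : ℕ, ∀ I : Set ℕ, I.Infinite → ∃ J : Finset ℕ, (J : Set ℕ) ⊆ I ∧ J.card = Q ∧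
      ∀ k ∈ J, ∀ l ∈ J, k ≠ l → Disjoint (T (m k) '' V k) (T (m l) '' V l) := by
    intro Q
    induction Q with
    | zero => intro I _; exact ⟨∅, by simp, rfl, by simp⟩
    | succ Q ih =>
      intro I hI
      obtain ⟨k, hk, I', hI', hinf, hdis⟩ := step I hI
      obtain ⟨J, hJ, hcard, hJd⟩ := ih I' hinf
      have hkJ : k ∉ J := by
        intro hkJ
        have := hdis k (hJ hkJ)
        exact Set.disjoint_left.1 this ⟨z, hzV k, rfl⟩ ⟨z, hzV k, rfl⟩
      refine ⟨insert k J, ?_, by rw [Finset.card_insert_of_notMem hkJ, hcard], ?_⟩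
      · intro l hl
        rcases Finset.mem_insert.1 hl with rfl | hl
        · exact hk
        · exact hI' (hJ hl)
      · intro a ha b hb hab
        rcases Finset.mem_insert.1 ha with rfl | ha1 <;> rcases Finset.mem_insert.1 hb with rfl | hb1
        · exact absurd rfl hab
        · exact hdis b (hJ hb1)
        · exact (hdis a (hJ ha1)).symm
        · exact hJd a ha1 b hb1 hab
  obtain ⟨F2, hF2⟩ := fin_net hreg (δ / 2) (by positivity)
  obtain ⟨N, hN⟩ := hV.small (Metric.ball z (δ / 2)) (Metric.ball_mem_nhds z (by positivity))
  obtain ⟨J, hJ, hcard, hJd⟩ := iter (F2.card + 1) (Set.Ici N) (Set.Ici_infinite N)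
  have hp : ∀ k ∈ J, ∃ p ∈ T (m k) '' V k, p ∈ F2 := by
    intro k hk
    have hkN : N ≤ k := hJ hk
    have d1 : dist (T (m k) (u k)) z < δ / 2 := hN k hkN (hmu k)
    have d2 := hm1 k
    have d3 := dist_triangle (T (m k) z) (T (m k) (u k)) z
    obtain ⟨p, hp, hpF, _⟩ := hF2 _ ((hV.conn k).image _ (hT.cont (m k)).continuousOn)
      (T (m k) z) ⟨z, hzV k, rfl⟩ (T (m k) (u k)) ⟨u k, hu k, rfl⟩ (by linarith)
    exact ⟨p, hp, hpF⟩
  choose! p hpA hpF using hp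
  obtain ⟨k, hk, l, hl, hkl, heq⟩ := Finset.exists_ne_map_eq_of_card_lt_of_maps_to
    (by omega : F2.card < J.card) (f := p) (fun k hk => hpF k hk)
  have h1 := hpA k hk
  rw [heq] at h1
  exact Set.disjoint_left.1 (hJd k hk l hl hkl) h1 (hpA l hl)


/-- `b` is an omega-limit point of `y`. -/
def InOm {X : Type*} [TopologicalSpace X] (T : ℤ → X → X) (b y : X) : Prop :=
  ∀ U ∈ nhds b, ∀ m : ℤ, ∃ n ≥ m, T n y ∈ U

/-- Almost periodicity of a point. -/
def APt {X : Type*} [TopologicalSpace X] (T : ℤ → X → X) (y : X) : Prop :=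
  ∀ U ∈ nhds y, ∃ S : Finset ℤ, ∀ n : ℤ, ∃ s ∈ S, T (n + s) y ∈ U

theorem ZAct.per_mul {X : Type*} [TopologicalSpace X] {T : ℤ → X → X} (hT : ZAct T) {x : X}
    {p : ℤ} (hp : T p x = x) {a : ℤ} (ha : p ∣ a) : T a x = x := by
  obtain ⟨k, rfl⟩ := ha
  have hneg : T (-p) x = x := by
    conv_lhs => rw [← hp]
    exact hT.cancel p x
  induction k using Int.induction_on with
  | zero => simpa using hT.zero x
  | succ i ih => rw [mul_add, mul_one, hT.add, hp, ih]
  | pred i ih => rw [mul_sub, mul_one, sub_eq_add_neg, hT.add, hneg, ih]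

theorem per_pos {X : Type*} [TopologicalSpace X] {T : ℤ → X → X} (hT : ZAct T) {x : X}
    (h : ¬ NonPer T x) : ∃ p : ℤ, 0 < p ∧ T p x = x := by
  unfold NonPer at h
  push Not at h
  obtain ⟨p, hp, hx⟩ := h
  exact ⟨|p|, abs_pos.2 hp, hT.per_mul hx ((dvd_abs p p).2 dvd_rfl)⟩

theorem dvd_add_emod (p n : ℤ) : p ∣ n + (-n) % p := by
  have h := Int.emod_add_mul_ediv (-n) p
  exact ⟨-((-n) / p), by linear_combination h⟩

theorem InOm.times {X : Type*} [TopologicalSpace X] {T : ℤ → X → X} {b y : X} (h : InOm T b y)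
    {U : Set X} (hU : U ∈ nhds b) (K : ℕ) :
    ∃ S : Finset ℤ, S.card = K ∧ ∀ τ ∈ S, 0 ≤ τ ∧ T τ y ∈ U := by
  have hinf : {n : ℤ | 0 ≤ n ∧ T n y ∈ U}.Infinite := by
    apply Set.infinite_of_not_bddAbove
    rintro ⟨M, hM⟩
    obtain ⟨n, hn, hnU⟩ := h U hU (max 0 (M + 1))
    have h1 : n ≤ M := hM ⟨le_trans (le_max_left _ _) hn, hnU⟩
    have h2 := le_trans (le_max_right 0 (M + 1)) hn
    omega
  obtain ⟨S, hS, hc⟩ := hinf.exists_subset_card_eq K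
  exact ⟨S, hc, fun τ hτ => hS hτ⟩

theorem lemma2 {X : Type*} [MetricSpace X] [CompactSpace X] [ConnectedSpace X]
    (hreg : RegCurve X) {T : ℤ → X → X} (hT : ZAct T)
    (hnw : ∀ x : X, ∀ U ∈ nhds x, ∃ n : ℤ, 0 < n ∧ ∃ u ∈ U, T n u ∈ U)
    (z : X) (hz : NonPer T z) : InOm T z z ∨ InOm (fun n => T (-n)) z z := by
  by_contra hcon
  unfold InOm at hcon
  push Not at hcon
  obtain ⟨⟨U1, hU1, m1, h1⟩, U2, hU2, m2, h2⟩ := hcon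
  obtain ⟨δ, hδ, hsub⟩ := Metric.mem_nhds_iff.1 (Filter.inter_mem hU1 hU2)
  obtain ⟨V, hV, hVp⟩ := lemmaL hreg hT z hz δ hδ
  set N := max m1 m2
  have hj : ∀ j : ℤ, j ∈ Finset.Ioo 0 N → ∃ Vj ∈ nhds z, ∀ u ∈ Vj, T j u ∉ Vj := by
    intro j hj
    obtain ⟨O1, O2, hO1, hO2, h1, h2, hd⟩ := t2_separation (hz j (by
      have := (Finset.mem_Ioo.1 hj).1; omega))
    refine ⟨O2 ∩ T j ⁻¹' O1, Filter.inter_mem (hO2.mem_nhds h2)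
      (hT.preim_nhds j z (hO1.mem_nhds h1)), ?_⟩
    intro u hu hu2
    exact Set.disjoint_left.1 hd hu.2 hu2.1
  choose! Vj hVj hVjp using hj
  have hmem : V ∩ ⋂ j ∈ Finset.Ioo 0 N, Vj j ∈ nhds z :=
    Filter.inter_mem hV ((Filter.biInter_finset_mem _).2 hVj)
  obtain ⟨n, hn, u, hu, hu2⟩ := hnw z _ hmem
  have hnN : N ≤ n := by
    by_contra hlt
    have hjm : n ∈ Finset.Ioo 0 N := Finset.mem_Ioo.2 ⟨hn, by omega⟩
    exact hVjp n hjm u (Set.mem_iInter₂.1 hu.2 n hjm) (Set.mem_iInter₂.1 hu2.2 n hjm)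
  rcases hVp n u hu.1 hu2.1 with h | h
  · exact h1 n (le_trans (le_max_left _ _) hnN) (hsub h).1
  · exact h2 n (le_trans (le_max_right _ _) hnN) (hsub h).2

theorem cross_avoid {X : Type*} [TopologicalSpace X] {G V : Set X} (hG : IsOpen G)
    (hfin : (frontier G).Finite) (hV : IsPreconnected V) {g : X → X} (hg : Continuous g)
    (hav : ∀ y ∈ V, g y ∉ hfin.toFinset) {a b : X} (ha : a ∈ V) (haG : g a ∈ G) (hb : b ∈ V) :
    g b ∈ G := by
  by_contra hbG
  obtain ⟨p, ⟨y, hy, rfl⟩, hp⟩ := crossing (hV.image g hg.continuousOn) hG ⟨a, ha, rfl⟩ haG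
    ⟨b, hb, rfl⟩ hbG
  exact hav y hy (by simpa using hp)

section om
variable {X : Type*} [MetricSpace X] [ConnectedSpace X] {T : ℤ → X → X}

theorem lemma3 (hreg : RegCurve X) (hT : ZAct T) {y b : X} (hy : InOm T y y) (hb : InOm T b y)
    (hbn : NonPer T b) : InOm T y b := by
  by_contra hcon
  unfold InOm at hcon
  push Not at hcon
  obtain ⟨U, hU, n0, hn0⟩ := hcon
  obtain ⟨G, hG, hyG, hGU, hfin⟩ := reg_nhds hreg y U hU
  obtain ⟨S, hS, hSp⟩ := hy.times (hG.mem_nhds hyG) (hfin.toFinset.card + 1)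
  obtain ⟨W, hW, hWp⟩ := count0 hT hfin.toFinset S (by omega) b hbn
  obtain ⟨V, hV, hVW, hVc⟩ := loc_conn hreg b W hW
  obtain ⟨n, _, hn⟩ := hb V hV 0
  have hmem : (⋂ τ ∈ S, T τ ⁻¹' G) ∈ nhds y := (Filter.biInter_finset_mem _).2
    (fun τ hτ => hT.preim_nhds τ y (hG.mem_nhds (hSp τ hτ).2))
  obtain ⟨w, hw, hwG⟩ := hy _ hmem (n + n0)
  obtain ⟨τ, hτ, hav⟩ := hWp (w - n)
  have h1 : T (w - n + τ) (T n y) ∈ G := by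
    rw [hT.comp_eq (c := τ + w) (by ring), hT.add]
    exact Set.mem_iInter₂.1 hwG τ hτ
  have h2 := cross_avoid hG hfin hVc (hT.cont (w - n + τ)) (fun y hy => hav y (hVW hy)) hn h1
    (mem_of_mem_nhds hV)
  refine hn0 (w - n + τ) ?_ (hGU (subset_closure h2))
  have := (hSp τ hτ).1
  omega

theorem lemma3' (hreg : RegCurve X) (hT : ZAct T) {y b : X} (hyn : NonPer T y)
    (hy : InOm T y y) (hb : InOm T y b) {U : Set X} (hU : U ∈ nhds y)
    (hneg : ∀ j : ℤ, 1 ≤ j → T (-j) b ∉ U) : False := by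
  obtain ⟨G, hG, hyG, hGU, hfin⟩ := reg_nhds hreg y U hU
  obtain ⟨S, hS, hSp⟩ := hy.times (hG.mem_nhds hyG) (hfin.toFinset.card + 1)
  obtain ⟨W, hW, hWp⟩ := count0 hT hfin.toFinset S (by omega) y hyn
  have hmem : (⋂ τ ∈ S, T τ ⁻¹' G) ∈ nhds y := (Filter.biInter_finset_mem _).2
    (fun τ hτ => hT.preim_nhds τ y (hG.mem_nhds (hSp τ hτ).2))
  obtain ⟨V, hV, hVW, hVc⟩ := loc_conn hreg y _ (Filter.inter_mem hW hmem)
  obtain ⟨M, hM⟩ := S.bddAbove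
  obtain ⟨n, _, hn⟩ := hb V hV 0
  obtain ⟨n', hn'le, hn'⟩ := hb V hV (2 * n + M + 1)
  obtain ⟨τ, hτ, hav⟩ := hWp (n - n')
  have h1 : T (n - n' + τ) (T n' b) ∈ G := by
    rw [hT.comp_eq (c := τ + n) (by ring), hT.add]
    exact Set.mem_iInter₂.1 (hVW hn).2 τ hτ
  have h2 := cross_avoid hG hfin hVc (hT.cont _) (fun y hy => hav y (hVW hy).1) hn' h1 hn
  have hτM : τ ≤ M := hM hτ
  refine hneg (n' - 2 * n - τ) (by omega) (hGU (subset_closure ?_))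
  rwa [hT.comp_eq (c := -(n' - 2 * n - τ)) (by ring)] at h2

theorem orbit_per (hT : ZAct T) {e : X} {q : ℤ} (hq : 0 < q) (he : T q e = e) :
    (Set.range fun n => T n e).Finite := by
  refine ((Finset.Ico 0 q).finite_toSet.image (fun n => T n e)).subset ?_
  rintro _ ⟨n, rfl⟩
  refine ⟨n % q, ?_, ?_⟩
  · simp only [Finset.coe_Ico, Set.mem_Ico]
    exact ⟨Int.emod_nonneg _ hq.ne', Int.emod_lt_of_pos _ hq⟩
  · have h := Int.emod_add_mul_ediv n q
    have h2 : T n e = T (n % q) (T (q * (n / q)) e) := by rw [hT.comp_eq h]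
    simp only
    rw [h2, hT.per_mul he ⟨_, rfl⟩]

theorem lemma4 (hreg : RegCurve X) (hT : ZAct T) {y e : X} (hyn : NonPer T y)
    (hy : InOm T y y) (hper : ∀ U ∈ nhds y, ∃ b ∈ U, ∃ p : ℤ, 0 < p ∧ T p b = b)
    {q : ℤ} (hq : 0 < q) (he : T q e = e) (hey : InOm T e y) : False := by
  have hU : (Set.range fun n => T n e)ᶜ ∈ nhds y := by
    apply (orbit_per hT hq he).isClosed.isOpen_compl.mem_nhds
    rintro ⟨n, rfl⟩
    refine hyn q hq.ne' ?_
    rw [hT.comp_eq (add_comm q n), hT.add, he]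
  obtain ⟨G, hG, hyG, hGU, hfin⟩ := reg_nhds hreg y _ hU
  obtain ⟨S, hS, hSp⟩ := hy.times (hG.mem_nhds hyG) (hfin.toFinset.card + 1)
  obtain ⟨W, hW, hWp⟩ := count0 hT hfin.toFinset S (by omega) y hyn
  have hmem : (⋂ τ ∈ S, T τ ⁻¹' G) ∈ nhds y := (Filter.biInter_finset_mem _).2
    (fun τ hτ => hT.preim_nhds τ y (hG.mem_nhds (hSp τ hτ).2))
  obtain ⟨V, hV, hVW, hVc⟩ := loc_conn hreg y _ (Filter.inter_mem hW hmem)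
  obtain ⟨b, hbV, p, hp, hpb⟩ := hper V hV
  have hmem2 : (⋂ j ∈ Finset.Ico 0 p, ⋂ τ ∈ S, T (j + τ) ⁻¹' (closure G)ᶜ) ∈ nhds e := by
    rw [Filter.biInter_finset_mem]
    intro j _
    rw [Filter.biInter_finset_mem]
    intro τ _
    apply hT.preim_nhds
    apply isClosed_closure.isOpen_compl.mem_nhds
    intro hcl
    exact hGU hcl ⟨_, rfl⟩
  obtain ⟨n, _, hn⟩ := hey _ hmem2 0
  set j := (-n) % p with hj
  have hjm : j ∈ Finset.Ico 0 p :=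
    Finset.mem_Ico.2 ⟨Int.emod_nonneg _ hp.ne', Int.emod_lt_of_pos _ hp⟩
  obtain ⟨τ, hτ, hav⟩ := hWp (n + j)
  have h1 : T (n + j + τ) b ∈ G := by
    rw [add_comm, hT.add, hT.per_mul hpb (dvd_add_emod p n)]
    exact Set.mem_iInter₂.1 (hVW hbV).2 τ hτ
  have h2 := cross_avoid hG hfin hVc (hT.cont _) (fun y hy => hav y (hVW hy).1) hbV h1
    (mem_of_mem_nhds hV)
  have h3 : T (j + τ) (T n y) ∈ (closure G)ᶜ :=
    Set.mem_iInter₂.1 (Set.mem_iInter₂.1 hn j hjm) τ hτ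
  rw [hT.comp_eq (c := n + j + τ) (by ring)] at h3
  exact h3 (subset_closure h2)

theorem lemma5 [CompactSpace X] (hreg : RegCurve X) (hT : ZAct T) {y e : X} (hyn : NonPer T y)
    (hy : InOm T y y) (hey : InOm T e y) : NonPer T e := by
  by_contra hcon
  obtain ⟨q, hq, he⟩ := per_pos hT hcon
  have h4 : ∃ U ∈ nhds y, ∀ b ∈ U, NonPer T b := by
    by_contra h
    push Not at h
    refine lemma4 hreg hT hyn hy ?_ hq he hey
    intro U hU
    obtain ⟨b, hb, hbn⟩ := h U hU
    exact ⟨b, hb, per_pos hT hbn⟩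
  obtain ⟨U, hU, hUn⟩ := h4
  obtain ⟨r, hr, hrU⟩ := Metric.nhds_basis_closedBall.mem_iff.1 hU
  have hball : Metric.ball y r ∈ nhds y := Metric.ball_mem_nhds y hr
  have hseq : ∀ k : ℕ, ∃ h : ℤ, (k : ℤ) ≤ h ∧ T h y ∈ Metric.ball y r ∧
      ∀ j : ℤ, 1 ≤ j → j ≤ k → T (h - j) y ∉ Metric.ball y r := by
    intro k
    have hmem : (⋂ j ∈ Finset.Icc (0 : ℤ) k, T j ⁻¹' (Metric.closedBall y r)ᶜ) ∈ nhds e := by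
      rw [Filter.biInter_finset_mem]
      intro j _
      apply hT.preim_nhds
      apply Metric.isClosed_closedBall.isOpen_compl.mem_nhds
      intro hcl
      refine hUn _ (hrU hcl) q hq.ne' ?_
      rw [hT.comp_eq (add_comm q j), hT.add, he]
    obtain ⟨n, hn0, hn⟩ := hey _ hmem 0
    have hex : ∃ d : ℕ, T (n + d) y ∈ Metric.ball y r := by
      obtain ⟨w, hw, hwb⟩ := hy _ hball n
      exact ⟨(w - n).toNat, by rwa [Int.toNat_of_nonneg (by omega), add_sub_cancel]⟩
    classical
    have hd := Nat.find_spec hex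
    have hmin := fun m => Nat.find_min hex (m := m)
    set d := Nat.find hex
    have hkd : k < d := by
      by_contra hle
      have := Set.mem_iInter₂.1 hn (d : ℤ) (Finset.mem_Icc.2 ⟨by omega, by omega⟩)
      simp only [Set.mem_preimage] at this
      rw [hT.comp_eq (add_comm (d : ℤ) n)] at this
      exact this (Metric.ball_subset_closedBall hd)
    refine ⟨n + d, by omega, hd, ?_⟩
    intro j hj1 hj2
    have := hmin (d - j).toNat (by omega)
    rw [Int.toNat_of_nonneg (by omega)] at this
    rwa [add_sub_assoc]
  choose h hkh hb hnb using hseq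
  obtain ⟨b, hbc⟩ := exists_clusterPt_of_compactSpace
    (Filter.map (fun k => T (h k) y) Filter.atTop)
  have hfreq : ∀ U ∈ nhds b, ∀ K : ℕ, ∃ k ≥ K, T (h k) y ∈ U := by
    intro U hU K
    have h1 : ∃ᶠ k in Filter.atTop, T (h k) y ∈ U := mapClusterPt_iff_frequently.1 hbc U hU
    obtain ⟨k, hk, hkU⟩ := Filter.frequently_atTop.1 h1 K
    exact ⟨k, hk, hkU⟩
  have hbn : NonPer T b := by
    apply hUn
    apply hrU
    rw [← Metric.isClosed_closedBall.closure_eq, mem_closure_iff_nhds]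
    intro t ht
    obtain ⟨k, _, hk⟩ := hfreq t ht 0
    exact ⟨_, hk, Metric.ball_subset_closedBall (hb k)⟩
  have hby : InOm T b y := by
    intro U hU m
    obtain ⟨k, hk, hkU⟩ := hfreq U hU m.toNat
    refine ⟨h k, ?_, hkU⟩
    have := hkh k
    omega
  refine lemma3' hreg hT hyn hy (lemma3 hreg hT hy hby hbn) hball ?_
  intro j hj hmem
  obtain ⟨k, hk, hkU⟩ := hfreq _ (hT.preim_nhds (-j) b (Metric.isOpen_ball.mem_nhds hmem)) j.toNat
  refine hnb k j hj (by omega) ?_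
  simp only [Set.mem_preimage] at hkU
  rwa [hT.comp_eq (c := h k - j) (by ring)] at hkU

theorem ap_per (hT : ZAct T) {y : X} {p : ℤ} (hp : 0 < p) (hy : T p y = y) : APt T y := by
  intro U hU
  refine ⟨Finset.Ico 0 p, fun n => ⟨(-n) % p, ?_, ?_⟩⟩
  · exact Finset.mem_Ico.2 ⟨Int.emod_nonneg _ hp.ne', Int.emod_lt_of_pos _ hp⟩
  · rw [hT.per_mul hy (dvd_add_emod p n)]
    exact mem_of_mem_nhds hU

theorem ap_om [CompactSpace X] (hreg : RegCurve X) (hT : ZAct T) {y : X} (hyn : NonPer T y)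
    (hy : InOm T y y) : APt T y := by
  intro U hU
  obtain ⟨O, hOU, hO, hyO⟩ := mem_nhds_iff.1 hU
  have hcl : IsClosed {b | InOm T b y} := by
    apply isClosed_of_closure_subset
    intro b hb V hV m
    obtain ⟨V', hV'V, hV', hbV'⟩ := mem_nhds_iff.1 hV
    obtain ⟨c, hcV, hc⟩ := mem_closure_iff.1 hb V' hV' hbV'
    obtain ⟨n, hn, hnV⟩ := hc V' (hV'.mem_nhds hcV) m
    exact ⟨n, hn, hV'V hnV⟩
  obtain ⟨S, hS⟩ := hcl.isCompact.elim_finite_subcover (fun n : ℤ => T n ⁻¹' O)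
    (fun n => hO.preimage (hT.cont n)) (by
      intro b hb
      obtain ⟨n, _, hn⟩ := lemma3 hreg hT hy hb (lemma5 hreg hT hyn hy hb) O (hO.mem_nhds hyO) 0
      exact Set.mem_iUnion.2 ⟨n, hn⟩)
  refine ⟨S, fun n => ?_⟩
  have hn : InOm T (T n y) y := by
    intro V hV m
    obtain ⟨k, hk, hkV⟩ := hy _ (hT.preim_nhds n y hV) (m - n)
    exact ⟨n + k, by omega, by rw [hT.add]; exact hkV⟩
  obtain ⟨s, hs, hsO⟩ := Set.mem_iUnion₂.1 (hS hn)
  refine ⟨s, hs, hOU ?_⟩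
  rw [add_comm, hT.add]
  exact hsO

theorem ap_all [CompactSpace X] (hreg : RegCurve X) (hT : ZAct T)
    (hnw : ∀ x : X, ∀ U ∈ nhds x, ∃ n : ℤ, 0 < n ∧ ∃ u ∈ U, T n u ∈ U) (y : X) : APt T y := by
  classical
  by_cases hyn : NonPer T y
  · rcases lemma2 hreg hT hnw y hyn with h | h
    · exact ap_om hreg hT hyn h
    · intro U hU
      obtain ⟨S, hS⟩ := ap_om hreg hT.rev hyn.rev h U hU
      refine ⟨S.image (fun s => -s), fun n => ?_⟩
      obtain ⟨s, hs, hsU⟩ := hS (-n)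
      refine ⟨-s, Finset.mem_image_of_mem _ hs, ?_⟩
      simp only at hsU
      rwa [neg_add, neg_neg] at hsU
  · obtain ⟨p, hp, hpy⟩ := per_pos hT hyn
    exact ap_per hT hp hpy

end om


section equi
variable {X : Type*} [MetricSpace X] {T : ℤ → X → X}

/-- Three points whose orbits are synchronously close to `x`. -/
def Sync (T : ℤ → X → X) (x z1 z2 z3 : X) : Prop :=
  ∀ W ∈ nhds x, ∃ V : Set X, V ⊆ W ∧ IsPreconnected V ∧ ∃ r : ℤ, T r z1 ∈ V ∧ T r z2 ∈ V ∧ T r z3 ∈ V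

theorem three_pts (ε : ℝ) (hε : 0 < ε) {F : Finset X}
    (hF : ∀ A : Set X, IsPreconnected A → ∀ a ∈ A, ∀ b ∈ A,
      ε / 8 ≤ dist a b → ∃ p ∈ A, p ∈ F ∧ dist a p < ε / 8) {A : Set X} (hA : IsPreconnected A)
    {a b : X} (ha : a ∈ A) (hb : b ∈ A) (hab : ε ≤ dist a b) :
    ∃ z1 ∈ F, ∃ z2 ∈ F, ∃ z3 ∈ F, z1 ≠ z2 ∧ z1 ≠ z3 ∧ z2 ≠ z3 ∧ z1 ∈ A ∧ z2 ∈ A ∧ z3 ∈ A := by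
  obtain ⟨c, hc, hac⟩ := hA.intermediate_value ha hb
    (f := fun c => dist a c) (by fun_prop) (show ε / 2 ∈ Set.Icc (dist a a) (dist a b) by
      rw [dist_self]; constructor <;> linarith)
  simp only at hac
  have hcb := dist_triangle a c b
  obtain ⟨p, hpA, hpF, hp⟩ := hF A hA a ha b hb (by linarith)
  obtain ⟨q, hqA, hqF, hq⟩ := hF A hA b hb a ha (by rw [dist_comm]; linarith)
  obtain ⟨r, hrA, hrF, hr⟩ := hF A hA c hc a ha (by rw [dist_comm]; linarith)
  refine ⟨p, hpF, q, hqF, r, hrF, ?_, ?_, ?_, hpA, hqA, hrA⟩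
  · rintro rfl
    have := dist_triangle_right a b p
    linarith
  · rintro rfl
    have := dist_triangle_right a c p
    linarith
  · rintro rfl
    have := dist_triangle_right c b q
    linarith

theorem sync_of_not_equi [CompactSpace X] [ConnectedSpace X] (hreg : RegCurve X) (hT : ZAct T)
    (x : X) (ε : ℝ) (hε : 0 < ε)
    (hcon : ∀ V ∈ nhds x, ∃ y ∈ V, ∃ n : ℤ, ε ≤ dist (T n x) (T n y)) :
    ∃ z1 z2 z3, z1 ≠ z2 ∧ z1 ≠ z3 ∧ z2 ≠ z3 ∧ Sync T x z1 z2 z3 := by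
  obtain ⟨V, hV⟩ := shrink_exists hreg x
  choose y hy n hn using fun k => hcon (V k) (hV.nhd k)
  obtain ⟨F, hF⟩ := fin_net hreg (ε / 8) (by positivity)
  obtain ⟨⟨z1, z2, z3⟩, _, hinf⟩ := pigeon (Set.univ : Set ℕ) Set.infinite_univ (F ×ˢ F ×ˢ F)
    (fun k z => z.1 ≠ z.2.1 ∧ z.1 ≠ z.2.2 ∧ z.2.1 ≠ z.2.2 ∧ z.1 ∈ T (n k) '' V k ∧
      z.2.1 ∈ T (n k) '' V k ∧ z.2.2 ∈ T (n k) '' V k) (by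
    intro k _
    obtain ⟨z1, h1, z2, h2, z3, h3, h⟩ := three_pts ε hε hF
      ((hV.conn k).image _ (hT.cont (n k)).continuousOn)
      ⟨x, mem_of_mem_nhds (hV.nhd k), rfl⟩ ⟨y k, hy k, rfl⟩ (hn k)
    exact ⟨(z1, z2, z3), by simp [h1, h2, h3], h⟩)
  obtain ⟨k0, _, h12, h13, h23, _⟩ := hinf.nonempty
  refine ⟨z1, z2, z3, h12, h13, h23, ?_⟩
  intro W hW
  obtain ⟨N, hN⟩ := hV.small W hW
  obtain ⟨k, ⟨_, _, _, _, ⟨a, ha, ha'⟩, ⟨b, hb, hb'⟩, ⟨c, hc, hc'⟩⟩, hk⟩ :=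
    (inf_large hinf (p := fun k => N ≤ k) N (fun k hk => hk)).nonempty
  simp only at ha' hb' hc'
  refine ⟨V k, hN k hk, hV.conn k, -(n k), ?_, ?_, ?_⟩
  · rw [← ha', hT.cancel]; exact ha
  · rw [← hb', hT.cancel]; exact hb
  · rw [← hc', hT.cancel]; exact hc

theorem sync_per (hT : ZAct T) {x z1 z2 z3 : X} (h12 : z1 ≠ z2) (hs : Sync T x z1 z2 z3)
    (hap : ∀ y, APt T y) {p : ℤ} (hp : 0 < p) (hx : T p x = x) : False := by
  have hfin : (Set.range fun n => T n x).Finite := by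
    refine ((Finset.Ico 0 p).finite_toSet.image (fun n => T n x)).subset ?_
    rintro _ ⟨n, rfl⟩
    refine ⟨n % p, ?_, ?_⟩
    · simp only [Finset.coe_Ico, Set.mem_Ico]
      exact ⟨Int.emod_nonneg _ hp.ne', Int.emod_lt_of_pos _ hp⟩
    · have h := Int.emod_add_mul_ediv n p
      have h2 : T n x = T (n % p) (T (p * (n / p)) x) := by rw [hT.comp_eq h]
      simp only
      rw [h2, hT.per_mul hx ⟨_, rfl⟩]
  have horb : ∀ z, (∀ W ∈ nhds x, ∃ r, T r z ∈ W) → ∃ n, T n x = z := by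
    intro z hz
    by_contra hcon
    have hmem : (Set.range fun n => T n x)ᶜ ∈ nhds z :=
      hfin.isClosed.isOpen_compl.mem_nhds (fun ⟨n, hn⟩ => hcon ⟨n, hn⟩)
    obtain ⟨r, hr, hrU⟩ := Metric.nhds_basis_closedBall.mem_iff.1 hmem
    obtain ⟨S, hS⟩ := hap z _ (Metric.closedBall_mem_nhds z hr)
    obtain ⟨n, hn⟩ := hz (⋂ s ∈ S, T s ⁻¹' (Metric.closedBall z r)ᶜ) (by
      rw [Filter.biInter_finset_mem]
      intro s _
      apply hT.preim_nhds
      apply Metric.isClosed_closedBall.isOpen_compl.mem_nhds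
      intro hcl
      exact hrU hcl ⟨s, rfl⟩)
    obtain ⟨s, hs, hsU⟩ := hS n
    have := Set.mem_iInter₂.1 hn s hs
    simp only [Set.mem_preimage] at this
    rw [hT.comp_eq (add_comm s n)] at this
    exact this hsU
  obtain ⟨n1, hn1⟩ := horb z1 (fun W hW => by
    obtain ⟨V, hVW, _, r, h1, h2, h3⟩ := hs W hW
    exact ⟨r, hVW h1⟩)
  obtain ⟨n2, hn2⟩ := horb z2 (fun W hW => by
    obtain ⟨V, hVW, _, r, h1, h2, h3⟩ := hs W hW
    exact ⟨r, hVW h2⟩)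
  have hmem : ((Set.range fun n => T n x) \ {x})ᶜ ∈ nhds x :=
    (hfin.subset Set.sdiff_subset).isClosed.isOpen_compl.mem_nhds (fun h => h.2 rfl)
  obtain ⟨V, hVW, _, r, h1, h2, h3⟩ := hs _ hmem
  have e1 : T r z1 = x := by
    by_contra hne
    exact hVW h1 ⟨⟨r + n1, by simp only [hT.add, hn1]⟩, hne⟩
  have e2 : T r z2 = x := by
    by_contra hne
    exact hVW h2 ⟨⟨r + n2, by simp only [hT.add, hn2]⟩, hne⟩
  exact h12 (hT.inj r (e1.trans e2.symm))

theorem nonper_of_near (hT : ZAct T) {x z : X} (hx : NonPer T x)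
    (hz : ∀ W ∈ nhds x, ∃ r, T r z ∈ W) : NonPer T z := by
  intro p hp hpz
  obtain ⟨O1, O2, hO1, hO2, h1, h2, hd⟩ := t2_separation (hx p hp)
  obtain ⟨r, hr⟩ := hz (O2 ∩ T p ⁻¹' O1)
    (Filter.inter_mem (hO2.mem_nhds h2) (hT.preim_nhds p x (hO1.mem_nhds h1)))
  have h3 : T p (T r z) ∈ O1 := hr.2
  rw [hT.comp_eq (add_comm p r), hT.add, hpz] at h3
  exact Set.disjoint_left.1 hd h3 hr.1

theorem bad_finite [CompactSpace X] (hreg : RegCurve X) (hT : ZAct T) {x z w : X}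
    (hx : NonPer T x) (hs : ∀ W ∈ nhds x, ∃ V : Set X, V ⊆ W ∧ IsPreconnected V ∧
      ∃ r : ℤ, T r z ∈ V ∧ T r w ∈ V) (η : ℝ) (hη : 0 < η) :
    {v : ℤ | η ≤ dist (T v z) (T v w)}.Finite := by
  by_contra hinf
  obtain ⟨F, hF⟩ := fin_net hreg η hη
  obtain ⟨S, hS, hcard⟩ := Set.Infinite.exists_subset_card_eq hinf (F.card + 1)
  obtain ⟨W, hW, hWp⟩ := count0 hT F S (by omega) x hx
  obtain ⟨V, hVW, hVc, r, h1, h2⟩ := hs W hW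
  obtain ⟨v, hv, hav⟩ := hWp (-r)
  have := small_of_avoid hF hVc (hT.cont (-r + v)) (fun y hy => hav y (hVW hy)) h1 h2
  rw [hT.comp_eq (c := v) (by ring), hT.comp_eq (c := v) (by ring)] at this
  have h3 : η ≤ dist (T v z) (T v w) := hS hv
  linarith

theorem sync_nonper [CompactSpace X] [ConnectedSpace X] (hreg : RegCurve X) (hT : ZAct T)
    {x z1 z2 z3 : X} (h12 : z1 ≠ z2) (h13 : z1 ≠ z3) (h23 : z2 ≠ z3)
    (hs : Sync T x z1 z2 z3) (hap : ∀ y, APt T y) (hx : NonPer T x) : False := by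
  have hn1 : NonPer T z1 := nonper_of_near hT hx (fun W hW => by
    obtain ⟨V, hVW, _, r, h1, h2, h3⟩ := hs W hW
    exact ⟨r, hVW h1⟩)
  have hn2 : NonPer T z2 := nonper_of_near hT hx (fun W hW => by
    obtain ⟨V, hVW, _, r, h1, h2, h3⟩ := hs W hW
    exact ⟨r, hVW h2⟩)
  have hn3 : NonPer T z3 := nonper_of_near hT hx (fun W hW => by
    obtain ⟨V, hVW, _, r, h1, h2, h3⟩ := hs W hW
    exact ⟨r, hVW h3⟩)
  obtain ⟨δ, hδ, hd12, hd13, hd23⟩ : ∃ δ : ℝ, 0 < δ ∧ 3 * δ ≤ dist z1 z2 ∧ 3 * δ ≤ dist z1 z3 ∧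
      3 * δ ≤ dist z2 z3 := by
    refine ⟨min (dist z1 z2) (min (dist z1 z3) (dist z2 z3)) / 3, ?_, ?_, ?_, ?_⟩
    · have := dist_pos.2 h12
      have := dist_pos.2 h13
      have := dist_pos.2 h23
      positivity
    · have := min_le_left (dist z1 z2) (min (dist z1 z3) (dist z2 z3))
      linarith
    · have := min_le_right (dist z1 z2) (min (dist z1 z3) (dist z2 z3))
      have := min_le_left (dist z1 z3) (dist z2 z3)
      linarith
    · have := min_le_right (dist z1 z2) (min (dist z1 z3) (dist z2 z3))
      have := min_le_right (dist z1 z3) (dist z2 z3)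
      linarith
  have b12 := bad_finite hreg hT (z := z1) (w := z2) hx (fun W hW => by
    obtain ⟨V, hVW, hc, r, h1, h2, h3⟩ := hs W hW
    exact ⟨V, hVW, hc, r, h1, h2⟩) δ hδ
  have b13 := bad_finite hreg hT (z := z1) (w := z3) hx (fun W hW => by
    obtain ⟨V, hVW, hc, r, h1, h2, h3⟩ := hs W hW
    exact ⟨V, hVW, hc, r, h1, h3⟩) δ hδ
  have b23 := bad_finite hreg hT (z := z2) (w := z3) hx (fun W hW => by
    obtain ⟨V, hVW, hc, r, h1, h2, h3⟩ := hs W hW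
    exact ⟨V, hVW, hc, r, h2, h3⟩) δ hδ
  obtain ⟨V1, hV1, hL1⟩ := lemmaL hreg hT z1 hn1 δ hδ
  obtain ⟨V2, hV2, hL2⟩ := lemmaL hreg hT z2 hn2 δ hδ
  obtain ⟨V3, hV3, hL3⟩ := lemmaL hreg hT z3 hn3 δ hδ
  obtain ⟨S1, hS1⟩ := hap z1 V1 hV1
  obtain ⟨S2, hS2⟩ := hap z2 V2 hV2
  obtain ⟨S3, hS3⟩ := hap z3 V3 hV3
  obtain ⟨⟨s1, s2, s3⟩, _, hinf⟩ := pigeon (Set.univ : Set ℤ) Set.infinite_univ (S1 ×ˢ S2 ×ˢ S3)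
    (fun n s => T (n + s.1) z1 ∈ V1 ∧ T (n + s.2.1) z2 ∈ V2 ∧ T (n + s.2.2) z3 ∈ V3) (by
    intro n _
    obtain ⟨s1, hs1, h1⟩ := hS1 n
    obtain ⟨s2, hs2, h2⟩ := hS2 n
    obtain ⟨s3, hs3, h3⟩ := hS3 n
    exact ⟨(s1, s2, s3), by simp [hs1, hs2, hs3], h1, h2, h3⟩)
  obtain ⟨n0, _, p1, p2, p3⟩ := hinf.nonempty
  have hBfin := (b12.union b13).union b23
  set B := ({v : ℤ | δ ≤ dist (T v z1) (T v z2)} ∪ {v : ℤ | δ ≤ dist (T v z1) (T v z3)}) ∪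
    {v : ℤ | δ ≤ dist (T v z2) (T v z3)} with hB
  have hB2 : ((fun m => n0 + m) '' B ∪ (fun m => n0 - m) '' B).Finite :=
    (hBfin.image _).union (hBfin.image _)
  obtain ⟨n, ⟨_, q1, q2, q3⟩, hnB⟩ := (hinf.sdiff hB2).nonempty
  simp only at p1 p2 p3 q1 q2 q3
  set m := n - n0 with hm
  have hmB : m ∉ B := fun h => hnB (Or.inl ⟨m, h, by simp [hm]⟩)
  have hmB' : -m ∉ B := fun h => hnB (Or.inr ⟨-m, h, by simp [hm]⟩)
  have r1 := hL1 m _ p1 (by rwa [hT.comp_eq (c := n + s1) (by rw [hm]; ring)])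
  have r2 := hL2 m _ p2 (by rwa [hT.comp_eq (c := n + s2) (by rw [hm]; ring)])
  have r3 := hL3 m _ p3 (by rwa [hT.comp_eq (c := n + s3) (by rw [hm]; ring)])
  simp only [hB, Set.mem_union, Set.mem_ofPred_eq, not_or, not_le] at hmB hmB'
  have close : ∀ e a b, dist (T e a) a < δ → dist (T e b) b < δ → dist (T e a) (T e b) < δ →
      3 * δ ≤ dist a b → False := by
    intro e a b h1 h2 h3 h4
    have t1 := dist_triangle a (T e a) b
    have t2 := dist_triangle (T e a) (T e b) b
    rw [dist_comm (T e a) a] at h1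
    linarith
  rcases r1 with r1 | r1 <;> rcases r2 with r2 | r2 <;> rcases r3 with r3 | r3
  · exact close m z1 z2 r1 r2 hmB.1.1 hd12
  · exact close m z1 z2 r1 r2 hmB.1.1 hd12
  · exact close m z1 z3 r1 r3 hmB.1.2 hd13
  · exact close (-m) z2 z3 r2 r3 hmB'.2 hd23
  · exact close m z2 z3 r2 r3 hmB.2 hd23
  · exact close (-m) z1 z3 r1 r3 hmB'.1.2 hd13
  · exact close (-m) z1 z2 r1 r2 hmB'.1.1 hd12
  · exact close (-m) z1 z2 r1 r2 hmB'.1.1 hd12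

theorem equi_pt [CompactSpace X] [ConnectedSpace X] (hreg : RegCurve X) (hT : ZAct T)
    (hnw : ∀ x : X, ∀ U ∈ nhds x, ∃ n : ℤ, 0 < n ∧ ∃ u ∈ U, T n u ∈ U)
    (x : X) (ε : ℝ) (hε : 0 < ε) :
    ∃ V ∈ nhds x, ∀ y ∈ V, ∀ n : ℤ, dist (T n x) (T n y) < ε := by
  by_contra hcon
  push Not at hcon
  obtain ⟨z1, z2, z3, h12, h13, h23, hs⟩ := sync_of_not_equi hreg hT x ε hε hcon
  have hap := ap_all hreg hT hnw
  by_cases hx : NonPer T x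
  · exact sync_nonper hreg hT h12 h13 h23 hs hap hx
  · obtain ⟨p, hp, hpx⟩ := per_pos hT hx
    exact sync_per hT h12 hs hap hp hpx

/-- Uniform equicontinuity. -/
theorem equi_unif [CompactSpace X] [ConnectedSpace X] (hreg : RegCurve X) (hT : ZAct T)
    (hnw : ∀ x : X, ∀ U ∈ nhds x, ∃ n : ℤ, 0 < n ∧ ∃ u ∈ U, T n u ∈ U)
    (ε : ℝ) (hε : 0 < ε) :
    ∃ δ > 0, ∀ x y : X, dist x y < δ → ∀ n : ℤ, dist (T n x) (T n y) < ε := by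
  have h := fun x => equi_pt hreg hT hnw x (ε / 2) (by positivity)
  choose V hV hVp using h
  obtain ⟨δ, hδ, hleb⟩ := lebesgue_number_lemma_of_metric (s := (Set.univ : Set X))
    (c := fun x => interior (V x)) isCompact_univ (fun x => isOpen_interior)
    (fun x _ => Set.mem_iUnion.2 ⟨x, mem_interior_iff_mem_nhds.2 (hV x)⟩)
  refine ⟨δ, hδ, fun x y hxy n => ?_⟩
  obtain ⟨c, hc⟩ := hleb x trivial
  have h1 := hVp c x (interior_subset (hc (Metric.mem_ball_self hδ))) n
  have h2 := hVp c y (interior_subset (hc (by rwa [Metric.mem_ball, dist_comm]))) n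
  have := dist_triangle_left (T n x) (T n y) (T n c)
  linarith

end equi

theorem hyper_lt {X : Type*} [MetricSpace X] [CompactSpace X] {A B : NonemptyCompacts X} {δ : ℝ}
    (h : dist A B < δ) : ∀ a ∈ A, ∃ b ∈ B, dist a b < δ := by
  intro a ha
  rw [Metric.NonemptyCompacts.dist_eq] at h
  exact Metric.exists_dist_lt_of_hausdorffDist_lt (s := (A : Set X)) (t := (B : Set X)) ha h
    (Metric.hausdorffEDist_ne_top_of_nonempty_of_bounded A.nonempty B.nonempty
      A.isCompact.isBounded B.isCompact.isBounded)

theorem iter_hyper {X : Type*} [MetricSpace X] (f : X → X) (hf : Continuous f) (k : ℕ)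
    (A : NonemptyCompacts X) :
    (((inducedHyper f hf)^[k] A : NonemptyCompacts X) : Set X) = f^[k] '' (A : Set X) := by
  induction k generalizing A with
  | zero => simp
  | succ k ih =>
    rw [Function.iterate_succ_apply, ih, Function.iterate_succ, Set.image_comp]
    rfl

theorem mem_iter_hyper {X : Type*} [MetricSpace X] (f : X → X) (hf : Continuous f) (k : ℕ)
    (A : NonemptyCompacts X) (y : X) :
    y ∈ (inducedHyper f hf)^[k] A ↔ ∃ a ∈ A, f^[k] a = y := by
  rw [← SetLike.mem_coe, iter_hyper]
  rfl

theorem entropy_zero {X : Type*} [MetricSpace X] [CompactSpace X] [Nonempty X]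
    (f : X → X) (hf : Continuous f)
    (heq : ∀ ε > 0, ∃ δ > 0, ∀ x y : X, dist x y < δ → ∀ n : ℕ, dist (f^[n] x) (f^[n] y) < ε) :
    Dynamics.coverEntropy (inducedHyper f hf) Set.univ = 0 := by
  classical
  obtain ⟨x0⟩ := ‹Nonempty X›
  apply le_antisymm _ (Dynamics.coverEntropy_nonneg _ ⟨({x0} : NonemptyCompacts X), Set.mem_univ _⟩)
  refine iSup₂_le fun U hU => ?_
  obtain ⟨ε, hε, hεU⟩ := Metric.mem_uniformity_dist.1 hU
  obtain ⟨δ, hδ, hδp⟩ := heq (ε / 2) (by positivity)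
  obtain ⟨t, _, htfin, htc⟩ := finite_cover_balls_of_compact
    (isCompact_univ : IsCompact (Set.univ : Set (NonemptyCompacts X))) hδ
  have hcov : ∀ n, Dynamics.IsDynCoverOf (inducedHyper f hf) Set.univ U n
      (htfin.toFinset : Set (NonemptyCompacts X)) := by
    intro n A _
    obtain ⟨B, hB, hAB⟩ := Set.mem_iUnion₂.1 (htc (Set.mem_univ A))
    refine ⟨B, by simpa using hB, ?_⟩
    change (A, B) ∈ Dynamics.dynEntourage (inducedHyper f hf) U n
    rw [Dynamics.mem_dynEntourage]
    intro k _
    apply hεU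
    rw [Metric.mem_ball] at hAB
    have hBA := hAB
    rw [dist_comm] at hBA
    refine lt_of_le_of_lt (b := ε / 2) ?_ (by linarith)
    rw [Metric.NonemptyCompacts.dist_eq]
    refine Metric.hausdorffDist_le_of_mem_dist (by positivity) ?_ ?_
    · intro y hy
      obtain ⟨a, ha, rfl⟩ := (mem_iter_hyper f hf k A y).1 hy
      obtain ⟨b, hb, hab⟩ := hyper_lt hAB a ha
      exact ⟨f^[k] b, (mem_iter_hyper f hf k B _).2 ⟨b, hb, rfl⟩, (hδp a b hab k).le⟩
    · intro y hy
      obtain ⟨b, hb, rfl⟩ := (mem_iter_hyper f hf k B y).1 hy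
      obtain ⟨a, ha, hab⟩ := hyper_lt hBA b hb
      exact ⟨f^[k] a, (mem_iter_hyper f hf k A _).2 ⟨a, ha, rfl⟩, (hδp b a hab k).le⟩
  have hne : htfin.toFinset.card ≠ 0 := by
    obtain ⟨B, hB, _⟩ := hcov 0 (Set.mem_univ ({x0} : NonemptyCompacts X))
    exact Finset.card_ne_zero_of_mem hB
  calc Dynamics.coverEntropyEntourage (inducedHyper f hf) Set.univ U
      ≤ ExpGrowth.expGrowthSup (fun _ : ℕ => (htfin.toFinset.card : ENNReal)) := by
        apply ExpGrowth.expGrowthSup_monotone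
        intro n
        have := ENat.toENNReal_mono (hcov n).coverMincard_le_card
        simpa using this
    _ = 0 := ExpGrowth.expGrowthSup_const (by exact_mod_cast hne) (ENNReal.natCast_ne_top _)

theorem sep_radius {X : Type*} [MetricSpace X] {U : Set X} (hU : IsOpen U) (Z : Finset X)
    (hZ : (Z : Set X) ⊆ U) :
    ∃ δ > 0, ∀ z ∈ Z, ∀ w, dist z w < δ → w ∈ U ∧ (w ∈ Z → w = z) := by
  classical
  have h : ∀ z ∈ Z, ∃ δ > 0, ∀ w, dist z w < δ → w ∈ U ∧ (w ∈ Z → w = z) := by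
    intro z hz
    have hmem : U ∩ ((Z : Set X) \ {z})ᶜ ∈ nhds z := Filter.inter_mem (hU.mem_nhds (hZ hz))
      ((Z.finite_toSet.subset Set.sdiff_subset).isClosed.isOpen_compl.mem_nhds (fun h => h.2 rfl))
    obtain ⟨δ, hδ, hsub⟩ := Metric.mem_nhds_iff.1 hmem
    refine ⟨δ, hδ, fun w hw => ?_⟩
    have := hsub (show w ∈ Metric.ball z δ by rwa [Metric.mem_ball, dist_comm])
    refine ⟨this.1, fun hwZ => ?_⟩
    by_contra hne
    exact this.2 ⟨hwZ, hne⟩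
  choose! δ hδ hp using h
  rcases Z.eq_empty_or_nonempty with rfl | hne
  · exact ⟨1, one_pos, by simp⟩
  · obtain ⟨z0, hz0, hmin⟩ := Z.exists_min_image δ hne
    exact ⟨δ z0, hδ z0 hz0, fun z hz w hw => hp z hz w (lt_of_lt_of_le hw (hmin z hz))⟩

/-- The compact set coded by a finite set of (time, point) pairs. -/
noncomputable def codeSet {X : Type*} [MetricSpace X] (T : ℤ → X → X) (x : X)
    (s : Finset (ℕ × X)) : NonemptyCompacts X :=
  ⟨⟨insert x ((fun q : ℕ × X => T (-(q.1 : ℤ)) q.2) '' (s : Set (ℕ × X))),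
    ((s.finite_toSet.image _).insert x).isCompact⟩, ⟨x, Set.mem_insert _ _⟩⟩

theorem mem_codeSet {X : Type*} [MetricSpace X] (T : ℤ → X → X) (x : X)
    (s : Finset (ℕ × X)) (y : X) :
    y ∈ codeSet T x s ↔ y = x ∨ ∃ q ∈ s, T (-(q.1 : ℤ)) q.2 = y := Iff.rfl

theorem entropy_top {X : Type*} [MetricSpace X] [CompactSpace X]
    (f : X → X) (hf : Continuous f) {T : ℤ → X → X} (hT : ZAct T)
    (hTf : ∀ (n : ℕ) x, T n x = f^[n] x) {U : Set X} (hU : IsOpen U) (hUinf : U.Infinite)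
    (hw : ∀ n : ℤ, n ≠ 0 → ∀ u ∈ U, T n u ∉ U) :
    Dynamics.coverEntropy (inducedHyper f hf) Set.univ = ⊤ := by
  classical
  obtain ⟨x, hx⟩ := hUinf.nonempty
  have key : ∀ p : ℕ, ENNReal.log ((2 : ENNReal) ^ p) ≤
      Dynamics.coverEntropy (inducedHyper f hf) Set.univ := by
    intro p
    obtain ⟨Z, hZU, hZc⟩ := hUinf.exists_subset_card_eq p
    obtain ⟨δ, hδ, hδp⟩ := sep_radius hU Z hZU
    set D : SetRel (NonemptyCompacts X) (NonemptyCompacts X) := {q | dist q.1 q.2 < δ / 2} with hD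
    have hDu : D ∈ uniformity (NonemptyCompacts X) := Metric.dist_mem_uniformity (by positivity)
    have hsub : ∀ n : ℕ, ∀ s ⊆ Finset.range n ×ˢ Z, ∀ s' ⊆ Finset.range n ×ˢ Z,
        (∀ k < n, dist ((inducedHyper f hf)^[k] (codeSet T (T 1 x) s))
          ((inducedHyper f hf)^[k] (codeSet T (T 1 x) s')) < δ) → s ⊆ s' := by
      intro n s hs s' hs' hd
      rintro ⟨k, z⟩ hq
      have h1 := Finset.mem_product.1 (hs hq)
      have hz : z ∈ Z := h1.2
      have hk : k < n := Finset.mem_range.1 h1.1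
      obtain ⟨w, hw', hzw⟩ := hyper_lt (hd k hk) z ((mem_iter_hyper f hf k _ z).2
        ⟨T (-(k : ℤ)) z, (mem_codeSet _ _ _ _).2 (Or.inr ⟨(k, z), hq, rfl⟩), by
          rw [← hTf, hT.cancel']⟩)
      obtain ⟨hwU, hwZ⟩ := hδp z hz w hzw
      obtain ⟨a, ha, rfl⟩ := (mem_iter_hyper f hf k _ w).1 hw'
      rw [← hTf] at *
      rcases (mem_codeSet _ _ _ _).1 ha with rfl | ⟨⟨j, y⟩, hjy, rfl⟩
      · rw [← hT.add] at hwU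
        exact absurd hwU (hw _ (by omega) x hx)
      · have h2 := Finset.mem_product.1 (hs' hjy)
        have hy : y ∈ Z := h2.2
        simp only at *
        rw [← hT.add] at hwU hwZ
        by_cases hjk : j = k
        · subst hjk
          rw [add_neg_cancel, hT.zero] at hwZ
          rw [← hwZ hy]
          exact hjy
        · exact absurd hwU (hw _ (by omega) y (hZU hy))
    have hinj : ∀ n : ℕ, Set.InjOn (codeSet T (T 1 x))
        ((Finset.range n ×ˢ Z).powerset : Set (Finset (ℕ × X))) := by
      intro n s hs s' hs' he
      have hs1 := Finset.mem_powerset.1 hs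
      have hs2 := Finset.mem_powerset.1 hs'
      apply Finset.Subset.antisymm
      · exact hsub n s hs1 s' hs2 (fun k _ => by rw [he, dist_self]; exact hδ)
      · exact hsub n s' hs2 s hs1 (fun k _ => by rw [he, dist_self]; exact hδ)
    have hnet : ∀ n : ℕ, Dynamics.IsDynNetIn (inducedHyper f hf) Set.univ D n
        (((Finset.range n ×ˢ Z).powerset.image (codeSet T (T 1 x)) : Finset _) :
          Set (NonemptyCompacts X)) := by
      intro n
      refine ⟨Set.subset_univ _, ?_⟩
      intro A hA B hB hAB
      obtain ⟨s, hs, rfl⟩ := Finset.mem_image.1 (Finset.mem_coe.1 hA)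
      obtain ⟨s', hs', rfl⟩ := Finset.mem_image.1 (Finset.mem_coe.1 hB)
      refine Set.disjoint_left.2 ?_
      intro C hC1 hC2
      apply hAB
      have hs1 := Finset.mem_powerset.1 hs
      have hs2 := Finset.mem_powerset.1 hs'
      have e1 := Dynamics.mem_ball_dynEntourage.1 hC1
      have e2 := Dynamics.mem_ball_dynEntourage.1 hC2
      have e3 : ∀ k < n, dist ((inducedHyper f hf)^[k] (codeSet T (T 1 x) s))
          ((inducedHyper f hf)^[k] (codeSet T (T 1 x) s')) < δ := by
        intro k hk
        have d1 : dist ((inducedHyper f hf)^[k] (codeSet T (T 1 x) s))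
          ((inducedHyper f hf)^[k] C) < δ / 2 := e1 k hk
        have d2 : dist ((inducedHyper f hf)^[k] (codeSet T (T 1 x) s'))
          ((inducedHyper f hf)^[k] C) < δ / 2 := e2 k hk
        have := dist_triangle_right ((inducedHyper f hf)^[k] (codeSet T (T 1 x) s))
          ((inducedHyper f hf)^[k] (codeSet T (T 1 x) s')) ((inducedHyper f hf)^[k] C)
        linarith
      congr 1
      apply Finset.Subset.antisymm
      · exact hsub n s hs1 s' hs2 e3
      · exact hsub n s' hs2 s hs1 (fun k hk => by rw [dist_comm]; exact e3 k hk)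
    calc ENNReal.log ((2 : ENNReal) ^ p)
        = ExpGrowth.expGrowthSup (fun n : ℕ => ((2 : ENNReal) ^ p) ^ n) :=
          ExpGrowth.expGrowthSup_pow.symm
      _ ≤ Dynamics.netEntropyEntourage (inducedHyper f hf) Set.univ D := by
          apply ExpGrowth.expGrowthSup_monotone
          intro n
          have h1 := ENat.toENNReal_mono (hnet n).card_le_netMaxcard
          rw [Finset.card_image_of_injOn (hinj n), Finset.card_powerset, Finset.card_product,
            Finset.card_range, hZc] at h1
          refine le_trans (le_of_eq ?_) h1
          simp only [← pow_mul]
          rw [mul_comm]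
          simp
      _ ≤ _ := Dynamics.netEntropyEntourage_le_coverEntropy _ _ hDu
  have hlim : Filter.Tendsto (fun p : ℕ => ENNReal.log ((2 : ENNReal) ^ p)) Filter.atTop
      (nhds ⊤) := by
    have h2 : Filter.Tendsto (fun p : ℕ => (2 : ENNReal) ^ p) Filter.atTop (nhds ⊤) :=
      ENNReal.tendsto_pow_atTop_nhds_top_iff.2 (by norm_num)
    have := (ENNReal.continuous_log.tendsto ⊤).comp h2
    rwa [ENNReal.log_top] at this
  exact top_le_iff.1 (le_of_tendsto' hlim key)

/-- The integer iterates of a homeomorphism. -/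
def iterZ {X : Type*} [TopologicalSpace X] (f : X ≃ₜ X) (n : ℤ) : X → X := ⇑(f ^ n)

theorem iterZ_act {X : Type*} [TopologicalSpace X] (f : X ≃ₜ X) : ZAct (iterZ f) where
  zero x := by simp [iterZ]
  add m n x := by simp only [iterZ, zpow_add]; rfl
  cont n := (f ^ n).continuous

theorem iterZ_nat {X : Type*} [TopologicalSpace X] (f : X ≃ₜ X) (n : ℕ) (x : X) :
    iterZ f n x = f^[n] x := by
  simp only [iterZ, zpow_natCast]
  induction n generalizing x with
  | zero => rfl
  | succ n ih =>
    rw [pow_succ, Function.iterate_succ_apply, ← ih]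
    rfl

/-- For a homeomorphism `f` of a regular curve: if `Ω(f) = X` then `h_top(2^f) = 0`,
and if `Ω(f) ≠ X` then `h_top(2^f) = +∞`; in particular `h_top(2^f) ∈ {0, +∞}`. -/
theorem entropy_inducedHyper_dichotomy {X : Type*}
    [MetricSpace X] [CompactSpace X] [ConnectedSpace X] [Nonempty X]
    (hreg : ∀ x : X, ∀ ε > (0 : ℝ), ∃ U : Set X,
      IsOpen U ∧ x ∈ U ∧ U ⊆ Metric.ball x ε ∧ (frontier U).Finite)
    (f : X ≃ₜ X) :
    (nonwandering (⇑f) = Set.univ →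
      Dynamics.coverEntropy (inducedHyper (⇑f) f.continuous) Set.univ = 0) ∧
    (nonwandering (⇑f) ≠ Set.univ →
      Dynamics.coverEntropy (inducedHyper (⇑f) f.continuous) Set.univ = ⊤) ∧
    Dynamics.coverEntropy (inducedHyper (⇑f) f.continuous) Set.univ ∈
      ({0, ⊤} : Set EReal) := by
  have hT := iterZ_act f
  have h1 : nonwandering (⇑f) = Set.univ →
      Dynamics.coverEntropy (inducedHyper (⇑f) f.continuous) Set.univ = 0 := by
    intro hnw
    apply entropy_zero
    intro ε hε
    obtain ⟨δ, hδ, hp⟩ := equi_unif (T := iterZ f) hreg hT (by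
      intro x U hU
      have hx : x ∈ nonwandering (⇑f) := by rw [hnw]; trivial
      obtain ⟨n, hn, u, hu1, hu2⟩ := hx U hU
      exact ⟨n, by exact_mod_cast hn, u, hu2, by rw [iterZ_nat]; exact hu1⟩) ε hε
    refine ⟨δ, hδ, fun x y hxy n => ?_⟩
    have := hp x y hxy n
    rwa [iterZ_nat, iterZ_nat] at this
  have h2 : nonwandering (⇑f) ≠ Set.univ →
      Dynamics.coverEntropy (inducedHyper (⇑f) f.continuous) Set.univ = ⊤ := by
    intro hne
    obtain ⟨x, hx⟩ := (Set.ne_univ_iff_exists_notMem _).1 hne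
    have hx2 : ∃ U ∈ nhds x, ∀ n : ℕ, 0 < n → ∀ u ∈ U, f^[n] u ∉ U := by
      by_contra hcon
      push Not at hcon
      apply hx
      intro U hU
      obtain ⟨n, hn, u, hu, hu2⟩ := hcon U hU
      exact ⟨n, hn, u, hu2, hu⟩
    obtain ⟨U', hU', hw'⟩ := hx2
    obtain ⟨U, hUU', hU, hxU⟩ := mem_nhds_iff.1 hU'
    have hfx : f x ≠ x := by
      intro h
      refine hw' 1 one_pos x (hUU' hxU) ?_
      rw [Function.iterate_one, h]
      exact hUU' hxU
    have : Nontrivial X := ⟨f x, x, hfx⟩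
    have hinf : U.Infinite := infinite_of_mem_nhds x (hU.mem_nhds hxU)
    refine entropy_top f f.continuous hT (iterZ_nat f) hU hinf ?_
    have hpos : ∀ n : ℤ, 0 < n → ∀ u ∈ U, iterZ f n u ∉ U := by
      intro n hn u hu hu2
      lift n to ℕ using hn.le
      rw [iterZ_nat] at hu2
      exact hw' n (by exact_mod_cast hn) u (hUU' hu) (hUU' hu2)
    intro n hn u hu hu2
    rcases lt_or_gt_of_ne hn with h | h
    · refine hpos (-n) (by omega) _ hu2 ?_
      rwa [hT.cancel]
    · exact hpos n h u hu hu2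
  refine ⟨h1, h2, ?_⟩
  by_cases h : nonwandering (⇑f) = Set.univ
  · exact Or.inl (h1 h)
  · exact Or.inr (h2 h)
end
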